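/- Measurable one-step superhedging (Lemma 4.9): Assume NA(𝒫) holds, fix t ∈ {0,…,T−1}, and let f : Ω_t × Ω₁ → ℝ̄ be upper semianalytic. Then the function ℰ_t(f) : Ω_t → ℝ̄ defined by ℰ_t(f)(ω) := sup_{Q ∈ 𝒬_t(ω)} E_Q[f(ω,·)] is upper semianalytic. Moreover, there exists a universally measurable function y(·) : Ω_t → ℝ^d such that ℰ_t(f)(ω) + y(ω)·ΔS_{t+1}(ω,·) ≥ f(ω,·) holds 𝒫_t(ω)-q.s. for every ω ∈ Ω_t such that NA(𝒫_t(ω)) holds and f(ω,·) > −∞ 𝒫_t(ω)-q.s. -/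

import Mathlib

open MeasureTheory Set Filter Topology
open scoped ENNReal NNReal

noncomputable section

namespace BN

/-- The universal completion of the ambient measurable structure on `α`:
a set is measurable iff it is null-measurable for every probability measure. -/
def univComp (α : Type*) [MeasurableSpace α] : MeasurableSpace α where
  MeasurableSet' s := ∀ μ : Measure α, IsProbabilityMeasure μ → NullMeasurableSet s μ
  measurableSet_empty := fun _ _ => MeasurableSet.empty.nullMeasurableSet
  measurableSet_compl := fun _ hs μ hμ => (hs μ hμ).compl
  measurableSet_iUnion := fun _ hf μ hμ => NullMeasurableSet.iUnion fun i => hf i μ hμ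

/-- `N` is `PP`-polar: it is contained in an `m`-measurable set which is null under
every `P ∈ PP`. -/
def IsPolar {α : Type*} [MeasurableSpace α] (PP : Set (Measure α)) (m : MeasurableSpace α)
    (N : Set α) : Prop :=
  ∃ A : Set α, MeasurableSet[m] A ∧ N ⊆ A ∧ ∀ P ∈ PP, P A = 0

/-- A property holds `PP`-quasi surely if its complement is `PP`-polar. -/
def QuasiSure {α : Type*} [mα : MeasurableSpace α] (PP : Set (Measure α))
    (m : MeasurableSpace α) (p : α → Prop) : Prop :=
  @IsPolar α mα PP m {ω | ¬ p ω}

/-- Expectation of a real random variable, with the convention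
`E[f] = E[f⁺] - E[f⁻]` and `∞ - ∞ = -∞` (which holds in `EReal`). -/
def expec {α : Type*} [MeasurableSpace α] (Q : Measure α) (f : α → ℝ) : EReal :=
  ((∫⁻ x, ENNReal.ofReal (f x) ∂Q : ℝ≥0∞) : EReal)
    - ((∫⁻ x, ENNReal.ofReal (-f x) ∂Q : ℝ≥0∞) : EReal)

/-- Positive part of an extended real, valued in `ℝ≥0∞`. -/
def posE (x : EReal) : ℝ≥0∞ := if x = ⊤ then ⊤ else ENNReal.ofReal x.toReal

/-- Expectation of an extended-real random variable, with the convention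
`E[f] = E[f⁺] - E[f⁻]` and `∞ - ∞ = -∞`. -/
def eexpec {α : Type*} [MeasurableSpace α] (Q : Measure α) (f : α → EReal) : EReal :=
  ((∫⁻ x, posE (f x) ∂Q : ℝ≥0∞) : EReal) - ((∫⁻ x, posE (-(f x)) ∂Q : ℝ≥0∞) : EReal)

/-- A real-valued function is upper semianalytic if all its strict superlevel sets
are analytic. -/
def UpperSemianalytic {α : Type*} [TopologicalSpace α] (f : α → ℝ) : Prop :=
  ∀ c : ℝ, AnalyticSet {x | c < f x}

/-- An extended-real-valued function is upper semianalytic if all its strict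
superlevel sets `{f > c}`, `c ∈ ℝ`, are analytic. -/
def UpperSemianalyticE {α : Type*} [TopologicalSpace α] (f : α → EReal) : Prop :=
  ∀ c : ℝ, AnalyticSet {x | (c : EReal) < f x}

/-- Convexity of a set of probability measures. -/
def ConvexPM {α : Type*} [MeasurableSpace α] (C : Set (ProbabilityMeasure α)) : Prop :=
  ∀ μ ∈ C, ∀ ν ∈ C, ∀ a b : ℝ≥0∞, a + b = 1 →
    ∀ ξ : ProbabilityMeasure α, (ξ : Measure α) = a • (μ : Measure α) + b • (ν : Measure α) →
      ξ ∈ C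

/-! ### The general (non-Polish) setting of Section 2 -/

section General

variable {Ω : Type*} [MeasurableSpace Ω]

/-- Predictability of a trading strategy `H` with respect to a filtration `F`:
the holding `H (u+1)` over the period `(u, u+1]` is `F u`-measurable. -/
def PredictableF (F : ℕ → MeasurableSpace Ω) (T d : ℕ) (H : ℕ → Ω → Fin d → ℝ) : Prop :=
  ∀ u : ℕ, u < T → Measurable[F u] (H (u + 1))

/-- The final gain `(H · S)_T` from trading `H` in the stocks `S`. -/
def gainF {d : ℕ} (S : ℕ → Ω → Fin d → ℝ) (H : ℕ → Ω → Fin d → ℝ) (T : ℕ) (ω : Ω) : ℝ :=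
  ∑ u : Fin T, ∑ i : Fin d, H (u + 1) ω i * (S (u + 1) ω i - S u ω i)

/-- The no-arbitrage condition `NA(PP)` (no options). -/
def NAF (F : ℕ → MeasurableSpace Ω) (T d : ℕ) (S : ℕ → Ω → Fin d → ℝ)
    (PP : Set (Measure Ω)) : Prop :=
  ∀ H : ℕ → Ω → Fin d → ℝ, PredictableF F T d H →
    QuasiSure PP ‹MeasurableSpace Ω› (fun ω => 0 ≤ gainF S H T ω) →
      QuasiSure PP ‹MeasurableSpace Ω› (fun ω => gainF S H T ω = 0)

/-- The cone `𝒞` of claims superreplicable from zero initial capital. -/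
def Cset (F : ℕ → MeasurableSpace Ω) (T d : ℕ) (S : ℕ → Ω → Fin d → ℝ) : Set (Ω → ℝ) :=
  {W | ∃ H : ℕ → Ω → Fin d → ℝ, PredictableF F T d H ∧
    ∃ K : Ω → ℝ, Measurable K ∧ (∀ ω, 0 ≤ K ω) ∧ ∀ ω, W ω = gainF S H T ω - K ω}

/-- The superhedging price (no options), with values in `EReal` (`inf ∅ = +∞`). -/
def superPriceF (F : ℕ → MeasurableSpace Ω) (T d : ℕ) (S : ℕ → Ω → Fin d → ℝ)
    (PP : Set (Measure Ω)) (f : Ω → ℝ) : EReal :=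
  sInf ((fun x : ℝ => (x : EReal)) ''
    {x : ℝ | ∃ H : ℕ → Ω → Fin d → ℝ, PredictableF F T d H ∧
      QuasiSure PP ‹MeasurableSpace Ω› (fun ω => f ω ≤ x + gainF S H T ω)})

end General

/-! ### The one-period setting of Section 3 -/

section OnePeriod

variable {Ω : Type*} [MeasurableSpace Ω] {d : ℕ}

/-- One-period no-arbitrage condition `NA(PP)` for the increment `ΔS`. -/
def NA1 (PP : Set (Measure Ω)) (ΔS : Ω → Fin d → ℝ) : Prop :=
  ∀ y : Fin d → ℝ,
    QuasiSure PP ‹MeasurableSpace Ω› (fun ω => 0 ≤ ∑ i, y i * ΔS ω i) →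
      QuasiSure PP ‹MeasurableSpace Ω› (fun ω => ∑ i, y i * ΔS ω i = 0)

/-- The martingale measures dominated by `PP` in the one-period market:
`𝒬 = {Q : Q ⋘ 𝒫, E_Q[ΔS] = 0}`. -/
def Q1set (PP : Set (Measure Ω)) (ΔS : Ω → Fin d → ℝ) : Set (Measure Ω) :=
  {Q | IsProbabilityMeasure Q ∧ (∃ P ∈ PP, Q ≪ P) ∧
    ∀ i, expec Q (fun ω => ΔS ω i) = 0}

/-- One-period superhedging price, with values in `EReal` (`inf ∅ = +∞`). -/
def superPrice1 (PP : Set (Measure Ω)) (ΔS : Ω → Fin d → ℝ) (f : Ω → ℝ) : EReal :=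
  sInf ((fun x : ℝ => (x : EReal)) ''
    {x : ℝ | ∃ H : Fin d → ℝ,
      QuasiSure PP ‹MeasurableSpace Ω› (fun ω => f ω ≤ x + ∑ i, H i * ΔS ω i)})

end OnePeriod

/-! ### The Polish multi-period setting -/

section Polish

variable (Ω₁ : Type) [MeasurableSpace Ω₁]

/-- Restriction of a path up to time `t`. -/
def restr {T : ℕ} (t : ℕ) (h : t ≤ T) (ω : Fin T → Ω₁) : Fin t → Ω₁ :=
  fun i => ω (Fin.castLE h i)

/-- Universally measurable predictability: `H u` (the holding over `(u, u+1]`)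
is a universally measurable function of the first `u` coordinates. -/
def Pred (d : ℕ) (H : (u : ℕ) → (Fin u → Ω₁) → Fin d → ℝ) : Prop :=
  ∀ u : ℕ, @Measurable _ _ (univComp (Fin u → Ω₁)) _ (H u)

/-- The gain `(H · S)_t = ∑_{u=1}^t H_u (S_u - S_{u-1})` up to time `t ≤ T`. -/
def gain {T d : ℕ} (S : (t : ℕ) → (Fin t → Ω₁) → Fin d → ℝ)
    (H : (u : ℕ) → (Fin u → Ω₁) → Fin d → ℝ) (t : ℕ) (h : t ≤ T) (ω : Fin T → Ω₁) : ℝ :=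
  ∑ u : Fin t, ∑ i : Fin d,
    H u (restr Ω₁ u (u.2.le.trans h) ω) i *
      (S (u + 1) (restr Ω₁ (u + 1) (Nat.succ_le_of_lt (u.2.trans_le h)) ω) i
        - S u (restr Ω₁ u (u.2.le.trans h) ω) i)

variable [TopologicalSpace Ω₁] [OpensMeasurableSpace Ω₁]

/-- The set `PP = {P₀ ⊗ ⋯ ⊗ P_{t-1}}` of measures built from universally
measurable selectors of the one-step collections `𝒫_s(·)`. -/
def MeasFam (Pt : (t : ℕ) → (Fin t → Ω₁) → Set (ProbabilityMeasure Ω₁)) :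
    (t : ℕ) → Set (Measure (Fin t → Ω₁))
  | 0 => {μ | μ = Measure.dirac Fin.elim0}
  | (t + 1) => {μ | ∃ ν ∈ MeasFam Pt t, ∃ κ : (Fin t → Ω₁) → ProbabilityMeasure Ω₁,
      @Measurable _ _ (univComp (Fin t → Ω₁)) (borel (ProbabilityMeasure Ω₁)) κ ∧
      (∀ ω, κ ω ∈ Pt t ω) ∧
      μ = ν.bind (fun ω => Measure.map (Fin.snoc ω) (κ ω : Measure Ω₁))}

/-- The σ-field `ℱ_t` on `Ω = Ω₁^T`: the comap under the restriction map of the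
universal completion of the Borel σ-field of `Ω₁^t`. -/
def filtr (T : ℕ) (t : ℕ) (h : t ≤ T) : MeasurableSpace (Fin T → Ω₁) :=
  MeasurableSpace.comap (restr Ω₁ t h) (univComp (Fin t → Ω₁))

/-- `S` is a `Q`-martingale with respect to the filtration `(ℱ_t)`. -/
def IsMartMeas {T d : ℕ} (S : (t : ℕ) → (Fin t → Ω₁) → Fin d → ℝ)
    (Q : Measure (Fin T → Ω₁)) : Prop :=
  (∀ (t : ℕ) (h : t ≤ T) (i : Fin d), Integrable (fun ω => S t (restr Ω₁ t h ω) i) Q) ∧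
  (∀ (t : ℕ) (h : t + 1 ≤ T) (i : Fin d) (A : Set (Fin T → Ω₁)),
    MeasurableSet[filtr Ω₁ T t ((Nat.le_succ t).trans h)] A →
      ∫ ω in A, S (t + 1) (restr Ω₁ (t + 1) h ω) i ∂Q
        = ∫ ω in A, S t (restr Ω₁ t ((Nat.le_succ t).trans h) ω) i ∂Q)

/-- The martingale measures `Q ⋘ PP` consistent with the option prices:
`𝒬 = {Q ⋘ PP : S is a Q-martingale, E_Q[gⁱ] = 0}`. -/
def QSet {T d e : ℕ} (PP : Set (Measure (Fin T → Ω₁)))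
    (S : (t : ℕ) → (Fin t → Ω₁) → Fin d → ℝ) (g : Fin e → (Fin T → Ω₁) → ℝ) :
    Set (Measure (Fin T → Ω₁)) :=
  {Q | IsProbabilityMeasure Q ∧ (∃ P ∈ PP, Q ≪ P) ∧ IsMartMeas Ω₁ S Q ∧
    ∀ i : Fin e, expec Q (g i) = 0}

/-- The no-arbitrage condition `NA(PP)` with semistatic trading in the stocks `S`
and the options `g`. -/
def NA {T d e : ℕ} (PP : Set (Measure (Fin T → Ω₁)))
    (S : (t : ℕ) → (Fin t → Ω₁) → Fin d → ℝ) (g : Fin e → (Fin T → Ω₁) → ℝ) : Prop :=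
  ∀ H : (u : ℕ) → (Fin u → Ω₁) → Fin d → ℝ, Pred Ω₁ d H → ∀ h : Fin e → ℝ,
    QuasiSure PP (univComp (Fin T → Ω₁))
      (fun ω => 0 ≤ gain Ω₁ S H T le_rfl ω + ∑ i, h i * g i ω) →
    QuasiSure PP (univComp (Fin T → Ω₁))
      (fun ω => gain Ω₁ S H T le_rfl ω + ∑ i, h i * g i ω = 0)

/-- The minimal semistatic superhedging price, valued in `EReal` (`inf ∅ = +∞`). -/
def superPrice {T d e : ℕ} (PP : Set (Measure (Fin T → Ω₁)))
    (S : (t : ℕ) → (Fin t → Ω₁) → Fin d → ℝ) (g : Fin e → (Fin T → Ω₁) → ℝ)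
    (f : (Fin T → Ω₁) → ℝ) : EReal :=
  sInf ((fun x : ℝ => (x : EReal)) ''
    {x : ℝ | ∃ H : (u : ℕ) → (Fin u → Ω₁) → Fin d → ℝ, ∃ h : Fin e → ℝ, Pred Ω₁ d H ∧
      QuasiSure PP (univComp (Fin T → Ω₁))
        (fun ω => f ω ≤ x + gain Ω₁ S H T le_rfl ω + ∑ i, h i * g i ω)})

/-- `f` is replicable by semistatic trading. -/
def Replicable {T d e : ℕ} (PP : Set (Measure (Fin T → Ω₁)))
    (S : (t : ℕ) → (Fin t → Ω₁) → Fin d → ℝ) (g : Fin e → (Fin T → Ω₁) → ℝ)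
    (f : (Fin T → Ω₁) → ℝ) : Prop :=
  ∃ x : ℝ, ∃ H : (u : ℕ) → (Fin u → Ω₁) → Fin d → ℝ, ∃ h : Fin e → ℝ, Pred Ω₁ d H ∧
    QuasiSure PP (univComp (Fin T → Ω₁))
      (fun ω => x + gain Ω₁ S H T le_rfl ω + ∑ i, h i * g i ω = f ω)

/-- The one-period increment `ΔS_{t+1}(ω, ·)` of the stock, given history `ω ∈ Ω_t`. -/
def incr {d : ℕ} (S : (t : ℕ) → (Fin t → Ω₁) → Fin d → ℝ) (t : ℕ) (ω : Fin t → Ω₁)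
    (x : Ω₁) : Fin d → ℝ :=
  fun i => S (t + 1) (Fin.snoc ω x) i - S t ω i

/-- The one-step martingale measures `𝒬_t(ω)` dominated by `𝒫_t(ω)`. -/
def Q1fam {d : ℕ} (Pt : (t : ℕ) → (Fin t → Ω₁) → Set (ProbabilityMeasure Ω₁))
    (S : (t : ℕ) → (Fin t → Ω₁) → Fin d → ℝ) (t : ℕ) (ω : Fin t → Ω₁) :
    Set (ProbabilityMeasure Ω₁) :=
  {Q | (∃ P' ∈ Pt t ω, (Q : Measure Ω₁) ≪ (P' : Measure Ω₁)) ∧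
    ∀ i, expec (Q : Measure Ω₁) (fun x => incr Ω₁ S t ω x i) = 0}

/-- `V` is a `Q`-supermartingale with respect to the filtration `(ℱ_t)`:
each `V_t` is `Q`-integrable and `E_Q[V_{t+1} | ℱ_t] ≤ V_t`. -/
def IsSupermart {T : ℕ} (V : ℕ → (Fin T → Ω₁) → ℝ) (Q : Measure (Fin T → Ω₁)) : Prop :=
  (∀ t : ℕ, t ≤ T → Integrable (V t) Q) ∧
  ∀ (t : ℕ) (h : t + 1 ≤ T) (A : Set (Fin T → Ω₁)),
    MeasurableSet[filtr Ω₁ T t ((Nat.le_succ t).trans h)] A →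
      ∫ ω in A, V (t + 1) ω ∂Q ≤ ∫ ω in A, V t ω ∂Q

end Polish

/-! ### Quasi-sure supports -/

/-- The quasi-sure support of a family of measures on `ℝ^d`. -/
def qsSupp {d : ℕ} (Rs : Set (Measure (Fin d → ℝ))) : Set (Fin d → ℝ) :=
  ⋂₀ {A : Set (Fin d → ℝ) | IsClosed A ∧ ∀ R ∈ Rs, R A = 1}

/-- The sequences bounded by `s` in their first `n` entries. -/
def boundedCyl (s : ℕ → ℕ) (n : ℕ) : Set (ℕ → ℕ) := {τ | ∀ i < n, τ i ≤ s i}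

lemma boundedCyl_zero (s : ℕ → ℕ) : boundedCyl s 0 = univ := by
  simp [boundedCyl]

lemma boundedCyl_congr {s s' : ℕ → ℕ} {n : ℕ} (h : ∀ i < n, s i = s' i) :
    boundedCyl s n = boundedCyl s' n := by
  ext τ
  refine forall₂_congr fun i hi => ?_
  rw [h i hi]

lemma boundedCyl_anti (s : ℕ → ℕ) : Antitone (boundedCyl s) :=
  fun _ _ hmn _ hτ i hi => hτ i (hi.trans_le hmn)

lemma monotone_boundedCyl_update (s : ℕ → ℕ) (n : ℕ) :
    Monotone fun j => boundedCyl (Function.update s n j) (n + 1) := by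
  intro j j' hj τ hτ i hi
  refine (hτ i hi).trans ?_
  by_cases h : i = n
  · subst h; simpa using hj
  · simp [h]

lemma iUnion_boundedCyl_update (s : ℕ → ℕ) (n : ℕ) :
    ⋃ j, boundedCyl (Function.update s n j) (n + 1) = boundedCyl s n := by
  ext τ
  simp only [mem_iUnion]
  constructor
  · rintro ⟨j, hj⟩ i hi
    simpa [hi.ne] using hj i (by omega)
  · intro h
    refine ⟨τ n, fun i hi => ?_⟩
    by_cases hin : i = n
    · subst hin; simp
    · simpa [hin] using h i (by omega)

/-- If a property of finite initial segments passes to some one-step refinement, then there is a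
branch all of whose initial segments have it. -/
lemma exists_branch {α : Type*} [Nonempty α] (p : ℕ → (ℕ → α) → Prop)
    (hcongr : ∀ n s s', (∀ i < n, s i = s' i) → p n s → p n s')
    (h0 : ∃ s, p 0 s) (hstep : ∀ n s, p n s → ∃ j, p (n + 1) (Function.update s n j)) :
    ∃ s, ∀ n, p n s := by
  choose! g hg using hstep
  obtain ⟨s₀, hs₀⟩ := h0
  let u : ℕ → ℕ → α := fun n => Nat.rec s₀ (fun n s => Function.update s n (g n s)) n
  have hu : ∀ n, u (n + 1) = Function.update (u n) n (g n (u n)) := fun n => rfl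
  have hp : ∀ n, p n (u n) := by
    intro n
    induction n with
    | zero => exact hs₀
    | succ n ih => rw [hu]; exact hg n _ ih
  have hst : ∀ i k, u (i + 1 + k) i = u (i + 1) i := by
    intro i k
    induction k with
    | zero => rfl
    | succ k ih =>
      rw [← add_assoc, hu, Function.update_of_ne (by omega), ih]
  refine ⟨fun i => u (i + 1) i, fun n => hcongr n (u n) _ (fun i hi => ?_) (hp n)⟩
  obtain ⟨k, rfl⟩ := Nat.exists_eq_add_of_le (Nat.succ_le_of_lt hi)
  exact hst i k

lemma isCompact_iInter_boundedCyl (s : ℕ → ℕ) : IsCompact {τ : ℕ → ℕ | ∀ i, τ i ≤ s i} := by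
  have : {τ : ℕ → ℕ | ∀ i, τ i ≤ s i} = Set.pi univ fun i => Set.Iic (s i) := by
    ext; simp only [mem_ofPred_eq, mem_univ_pi, mem_Iic]
  rw [this]
  exact isCompact_univ_pi fun i => (Set.finite_Iic (s i)).isCompact

/-- An open neighbourhood of the compact set of sequences bounded by `s` contains
one of the bounded cylinders of `s`. -/
lemma exists_boundedCyl_subset (s : ℕ → ℕ) {U : Set (ℕ → ℕ)} (hU : IsOpen U)
    (hsU : {τ : ℕ → ℕ | ∀ i, τ i ≤ s i} ⊆ U) : ∃ n, boundedCyl s n ⊆ U := by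
  have hcyl : ∀ τ ∈ {τ : ℕ → ℕ | ∀ i, τ i ≤ s i}, ∃ n, PiNat.cylinder τ n ⊆ U := by
    intro τ hτ
    obtain ⟨v, ⟨x, n, rfl⟩, hx, hv⟩ :=
      (PiNat.isTopologicalBasis_cylinders (fun _ : ℕ => ℕ)).exists_subset_of_mem_open (hsU hτ) hU
    exact ⟨n, by rwa [PiNat.mem_cylinder_iff_eq.1 hx]⟩
  choose! m hm using hcyl
  obtain ⟨t, ht, hcov⟩ := (isCompact_iInter_boundedCyl s).elim_nhds_subcover
    (fun τ => PiNat.cylinder τ (m τ))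
    (fun τ _ => (PiNat.isOpen_cylinder _ τ (m τ)).mem_nhds (PiNat.self_mem_cylinder τ (m τ)))
  refine ⟨t.sup m, fun τ hτ => ?_⟩
  let τ' : ℕ → ℕ := fun i => if i < t.sup m then τ i else 0
  have hτ' : τ' ∈ {τ : ℕ → ℕ | ∀ i, τ i ≤ s i} := by
    intro i
    by_cases hi : i < t.sup m
    · exact (if_pos hi).trans_le (hτ i hi)
    · exact (if_neg hi).trans_le (Nat.zero_le _)
  obtain ⟨σ, hσt, hσ⟩ := mem_iUnion₂.1 (hcov hτ')
  refine hm σ (ht σ hσt) fun i hi => ?_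
  have hi' : i < t.sup m := hi.trans_le (Finset.le_sup hσt)
  exact (if_pos hi').symm.trans (hσ i hi)

section Capacity

variable {X : Type*} [TopologicalSpace X] [T2Space X] {h : (ℕ → ℕ) → X}

lemma iInter_closure_image_boundedCyl_subset (hh : Continuous h) (s : ℕ → ℕ) :
    ⋂ n, closure (h '' boundedCyl s n) ⊆ range h := by
  intro x hx
  by_contra hxr
  have hK := (isCompact_iInter_boundedCyl s).image hh
  have hxK : x ∉ h '' {τ : ℕ → ℕ | ∀ i, τ i ≤ s i} := fun hc => hxr (image_subset_range _ _ hc)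
  obtain ⟨U, V, hU, hV, hxU, hKV, hUV⟩ :=
    SeparatedNhds.of_isCompact_isCompact isCompact_singleton hK
      (disjoint_singleton_left.2 hxK)
  obtain ⟨n, hn⟩ := exists_boundedCyl_subset s (hV.preimage hh) (image_subset_iff.1 hKV)
  have hcl : x ∈ closure V := closure_mono (image_subset_iff.2 hn) (mem_iInter.1 hx n)
  exact (hUV.closure_right hU).le_bot ⟨hxU rfl, hcl⟩

variable [MeasurableSpace X] [OpensMeasurableSpace X]

/-- The measure of a continuous image of the Baire space exceeds `r` iff it does so uniformly
along the closures of the bounded cylinders of some branch. -/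
lemma lt_measure_range_iff (hh : Continuous h) (μ : Measure X) [IsFiniteMeasure μ] (r : ℝ≥0∞) :
    r < μ (range h) ↔
      ∃ r' : ℚ, r < ENNReal.ofReal r' ∧
        ∃ s : ℕ → ℕ, ∀ n, ENNReal.ofReal r' ≤ μ (closure (h '' boundedCyl s n)) := by
  constructor
  · intro hr
    obtain ⟨r', -, hr₁, hr₂⟩ := ENNReal.lt_iff_exists_rat_btwn.1 hr
    refine ⟨r', hr₁, ?_⟩
    change ENNReal.ofReal r' < _ at hr₂
    obtain ⟨s, hs⟩ := exists_branch
      (fun n s => ENNReal.ofReal r' < μ (h '' boundedCyl s n))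
      (fun n s s' hss hp => by rwa [← boundedCyl_congr hss])
      ⟨fun _ => 0, by simpa [boundedCyl_zero] using hr₂⟩
      (fun n s hp => by
        rw [← iUnion_boundedCyl_update, image_iUnion, Monotone.measure_iUnion] at hp
        · exact lt_iSup_iff.1 hp
        · exact fun j j' hj => image_mono (monotone_boundedCyl_update s n hj))
    exact ⟨s, fun n => (hs n).le.trans (measure_mono subset_closure)⟩
  · rintro ⟨r', hr, s, hs⟩
    refine hr.trans_le (le_trans ?_ (measure_mono (iInter_closure_image_boundedCyl_subset hh s)))
    rw [Antitone.measure_iInter]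
    · exact le_iInf hs
    · exact fun m n hmn => closure_mono (image_mono (boundedCyl_anti s hmn))
    · exact fun n => isClosed_closure.measurableSet.nullMeasurableSet
    · exact ⟨0, measure_ne_top _ _⟩

/-- Analytic sets are universally measurable. -/
lemma _root_.MeasureTheory.AnalyticSet.nullMeasurableSet {A : Set X} (hA : AnalyticSet A)
    (μ : Measure X) [IsFiniteMeasure μ] : NullMeasurableSet A μ := by
  rw [AnalyticSet] at hA
  rcases hA with rfl | ⟨h, hh, rfl⟩
  · exact nullMeasurableSet_empty
  have key : ∀ r < μ (range h), ∃ F, MeasurableSet F ∧ F ⊆ range h ∧ r < μ F := by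
    intro r hr
    obtain ⟨r', hr', s, hs⟩ := (lt_measure_range_iff hh μ r).1 hr
    refine ⟨⋂ n, closure (h '' boundedCyl s n),
      MeasurableSet.iInter fun n => isClosed_closure.measurableSet,
      iInter_closure_image_boundedCyl_subset hh s, hr'.trans_le ?_⟩
    rw [Antitone.measure_iInter]
    · exact le_iInf hs
    · exact fun m n hmn => closure_mono (image_mono (boundedCyl_anti s hmn))
    · exact fun n => isClosed_closure.measurableSet.nullMeasurableSet
    · exact ⟨0, measure_ne_top _ _⟩
  rcases eq_or_ne (μ (range h)) 0 with h0 | h0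
  · exact NullMeasurableSet.of_null h0
  obtain ⟨u, -, hu, hlim⟩ := exists_seq_strictMono_tendsto' (pos_iff_ne_zero.2 h0)
  choose F hFm hFs hFr using fun n => key (u n) (hu n).2
  have hle : μ (range h) ≤ μ (⋃ n, F n) :=
    le_of_tendsto' hlim fun n => (hFr n).le.trans (measure_mono (subset_iUnion F n))
  have hsub : ⋃ n, F n ⊆ range h := iUnion_subset hFs
  have hm : MeasurableSet (⋃ n, F n) := MeasurableSet.iUnion hFm
  refine hm.nullMeasurableSet.congr ?_
  exact ae_eq_of_subset_of_measure_ge hsub hle hm.nullMeasurableSet (measure_ne_top _ _)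

end Capacity

section Reflection

variable {X : Type*} [MeasurableSpace X]

/-- `A` has a measurable superset with measure at most `ε` under all the measures in `M`. -/
def SepLE (ε : ℝ≥0∞) (A : Set X) (M : Set (ProbabilityMeasure X)) : Prop :=
  ∃ B, MeasurableSet B ∧ A ⊆ B ∧ ∀ P ∈ M, (P : Measure X) B ≤ ε

lemma sepLE_iUnion {ε : ℝ≥0∞} {A : ℕ → Set X} (hA : Monotone A)
    {M : ℕ → Set (ProbabilityMeasure X)} (h : ∀ i j, SepLE ε (A i) (M j)) :
    SepLE ε (⋃ i, A i) (⋃ j, M j) := by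
  choose B hBm hAB hB using h
  refine ⟨⋃ n, ⋂ i ≥ n, ⋂ j, B i j, ?_, ?_, ?_⟩
  · exact .iUnion fun n => .iInter fun i => .iInter fun _ => .iInter fun j => hBm i j
  · refine iUnion_subset fun n x hx => mem_iUnion.2 ⟨n, ?_⟩
    simp only [mem_iInter]
    exact fun i hi j => hAB i j (hA hi hx)
  · intro P hP
    obtain ⟨j, hj⟩ := mem_iUnion.1 hP
    rw [Monotone.measure_iUnion]
    · exact iSup_le fun n => (measure_mono fun x hx => by
        simp only [mem_iInter] at hx
        exact hx n le_rfl j).trans (hB n j P hj)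
    · intro m n hmn x hx
      simp only [mem_iInter] at hx ⊢
      exact fun i hi j => hx i (le_trans hmn hi) j

variable [TopologicalSpace X] [PolishSpace X] [BorelSpace X]

/-- An analytic set which is null under every member of an analytic set of probability measures
is contained in a Borel set with the same property. -/
lemma exists_measurableSet_superset_null {A : Set X} (hA : AnalyticSet A)
    {M : Set (ProbabilityMeasure X)} (hM : AnalyticSet M)
    (hnull : ∀ P ∈ M, (P : Measure X) A = 0) :
    ∃ B, MeasurableSet B ∧ A ⊆ B ∧ ∀ P ∈ M, (P : Measure X) B = 0 := by
  rw [AnalyticSet] at hA hM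
  rcases hA with rfl | ⟨h, hh, rfl⟩
  · exact ⟨∅, .empty, subset_rfl, by simp⟩
  rcases hM with rfl | ⟨p, hp, rfl⟩
  · exact ⟨univ, .univ, subset_univ _, by simp⟩
  have key : ∀ k : ℕ, SepLE ((k : ℝ≥0∞) + 1)⁻¹ (range h) (range p) := by
    intro k
    by_contra hk
    set ε : ℝ≥0∞ := ((k : ℝ≥0∞) + 1)⁻¹ with hε
    have hε0 : 0 < ε := ENNReal.inv_pos.2 (by finiteness)
    obtain ⟨s, hs⟩ := exists_branch
      (fun n (s : ℕ → ℕ × ℕ) => ¬ SepLE ε (h '' boundedCyl (Prod.fst ∘ s) n)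
        (p '' PiNat.cylinder (Prod.snd ∘ s) n))
      (fun n s s' hss hn => by
        rwa [← boundedCyl_congr (s := Prod.fst ∘ s) (fun i hi => by simp [hss i hi]),
          show PiNat.cylinder (Prod.snd ∘ s') n = PiNat.cylinder (Prod.snd ∘ s) n from
            PiNat.mem_cylinder_iff_eq.1 fun i hi => by simp [hss i hi]])
      ⟨fun _ => (0, 0), by simpa [boundedCyl_zero] using hk⟩
      (fun n s hn => by
        by_contra! hall
        refine hn ?_
        rw [← iUnion_boundedCyl_update, image_iUnion, ← PiNat.iUnion_cylinder_update,
          image_iUnion]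
        refine sepLE_iUnion
          (fun j j' hj => image_mono (monotone_boundedCyl_update _ n hj)) fun i j => ?_
        simpa [Function.comp_update] using hall (i, j))
    have hex : ∀ n, ∃ τ ∈ PiNat.cylinder (Prod.snd ∘ s) n,
        ε < (p τ : Measure X) (closure (h '' boundedCyl (Prod.fst ∘ s) n)) := by
      intro n
      by_contra! hcon
      exact hs n ⟨_, isClosed_closure.measurableSet, subset_closure, by
        rintro _ ⟨τ, hτ, rfl⟩
        exact hcon τ hτ⟩
    choose τ hτ hτε using hex
    have hlim : Tendsto τ atTop (𝓝 (Prod.snd ∘ s)) := by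
      rw [tendsto_pi_nhds]
      intro i
      refine tendsto_const_nhds.congr' ?_
      filter_upwards [eventually_gt_atTop i] with n hn
      exact (hτ n i hn).symm
    have hcl : ∀ n, ε ≤ (p (Prod.snd ∘ s) : Measure X)
        (closure (h '' boundedCyl (Prod.fst ∘ s) n)) := by
      intro n
      refine le_trans ?_ (ProbabilityMeasure.limsup_measure_closed_le_of_tendsto
        ((hp.tendsto _).comp hlim) isClosed_closure)
      refine le_limsup_of_frequently_le (Eventually.frequently ?_)
      filter_upwards [eventually_ge_atTop n] with m hm
      exact (hτε m).le.trans
        (measure_mono (closure_mono (image_mono (boundedCyl_anti _ hm))))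
    have h0 : ε ≤ (p (Prod.snd ∘ s) : Measure X) (range h) := by
      refine le_trans ?_
        (measure_mono (iInter_closure_image_boundedCyl_subset hh (Prod.fst ∘ s)))
      rw [Antitone.measure_iInter]
      · exact le_iInf hcl
      · exact fun m n hmn => closure_mono (image_mono (boundedCyl_anti _ hmn))
      · exact fun n => isClosed_closure.measurableSet.nullMeasurableSet
      · exact ⟨0, measure_ne_top _ _⟩
    rw [hnull _ (mem_range_self _)] at h0
    exact hε0.not_ge h0
  choose B hBm hAB hB using key
  refine ⟨⋂ k, B k, .iInter hBm, subset_iInter hAB, fun P hP => ?_⟩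
  refine le_antisymm (ge_of_tendsto' ENNReal.tendsto_inv_nat_nhds_zero fun k => ?_) zero_le
  rcases k with _ | k
  · simp
  · refine (measure_mono (iInter_subset B k)).trans ((hB k P hP).trans ?_)
    simp

end Reflection

open ProbabilityTheory

section Kernel

variable {X Y : Type*} [TopologicalSpace X] [PolishSpace X] [MeasurableSpace X] [BorelSpace X]
  [TopologicalSpace Y] [MeasurableSpace Y] [BorelSpace Y]

/-- A continuous family of probability measures is a measurable family. -/
lemma measurable_coe_of_continuous {p : Y → ProbabilityMeasure X} (hp : Continuous p) :
    Measurable fun y => (p y : Measure X) := by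
  refine Measurable.measure_of_isPiSystem_of_isProbabilityMeasure (S := {F | IsClosed F})
    (BorelSpace.measurable_eq.trans borel_eq_generateFrom_isClosed) isPiSystem_isClosed
    fun F hF => ?_
  refine measurable_of_Iio fun c => IsOpen.measurableSet ?_
  rw [isOpen_iff_mem_nhds]
  intro y hy
  have := ProbabilityMeasure.limsup_measure_closed_le_of_tendsto (hp.tendsto y) hF
  exact eventually_lt_of_limsup_lt (this.trans_lt hy)

lemma measurable_kernel_closure_boundedCyl (κ : Kernel Y X) [IsFiniteKernel κ]
    (h : (ℕ → ℕ) → Y × X) (n : ℕ) :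
    Measurable fun p : Y × (ℕ → ℕ) =>
      κ p.1 (Prod.mk p.1 ⁻¹' closure (h '' boundedCyl p.2 n)) := by
  let e : (Fin n → ℕ) → ℕ → ℕ := fun u i => if hi : i < n then u ⟨i, hi⟩ else 0
  let g : Y × (Fin n → ℕ) → ℝ≥0∞ := fun p =>
    κ p.1 (Prod.mk p.1 ⁻¹' closure (h '' boundedCyl (e p.2) n))
  have hu : ∀ u : Fin n → ℕ, Measurable fun y : Y =>
      κ y (Prod.mk y ⁻¹' closure (h '' boundedCyl (e u) n)) := fun u =>
    Kernel.measurable_kernel_prodMk_left isClosed_closure.measurableSet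
  have hg : Measurable g := measurable_from_prod_countable_left hu
  have hr : Measurable fun p : Y × (ℕ → ℕ) => (p.1, fun i : Fin n => p.2 i) := by fun_prop
  convert hg.comp hr using 2 with p
  simp only [g, Function.comp]
  rw [boundedCyl_congr (s := p.2) (s' := e fun i : Fin n => p.2 i) fun i hi => by simp [e, hi]]

variable [PolishSpace Y]

/-- The measure of the sections of an analytic set is upper semianalytic. -/
lemma analyticSet_lt_kernel (κ : Kernel Y X) [IsFiniteKernel κ] {A : Set (Y × X)}
    (hA : AnalyticSet A) (r : ℝ≥0∞) : AnalyticSet {y | r < κ y (Prod.mk y ⁻¹' A)} := by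
  rw [AnalyticSet] at hA
  rcases hA with rfl | ⟨h, hh, rfl⟩
  · simpa using analyticSet_empty
  have hmap : ∀ (y : Y) (C : Set (Y × X)),
      (κ y).map (Prod.mk y) C = κ y (Prod.mk y ⁻¹' C) := fun y C =>
    (measurableEmbedding_prodMk_left y).map_apply _ _
  have : {y | r < κ y (Prod.mk y ⁻¹' range h)} = ⋃ r' : {r' : ℚ // r < ENNReal.ofReal r'},
      Prod.fst '' {p : Y × (ℕ → ℕ) | ∀ n, ENNReal.ofReal (r' : ℚ) ≤
        κ p.1 (Prod.mk p.1 ⁻¹' closure (h '' boundedCyl p.2 n))} := by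
    ext y
    have := lt_measure_range_iff hh ((κ y).map (Prod.mk y)) r
    simp only [hmap] at this
    simp only [mem_ofPred_eq, this, mem_iUnion, mem_image, Prod.exists, Subtype.exists]
    constructor
    · rintro ⟨r', h₁, s, hs⟩
      exact ⟨r', h₁, y, s, hs, rfl⟩
    · rintro ⟨r', h₁, y', s, hs, rfl⟩
      exact ⟨r', h₁, s, hs⟩
  rw [this]
  refine AnalyticSet.iUnion fun r' => AnalyticSet.image_of_continuous ?_ continuous_fst
  refine MeasurableSet.analyticSet ?_
  have : {p : Y × (ℕ → ℕ) | ∀ n, ENNReal.ofReal (r' : ℚ) ≤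
      κ p.1 (Prod.mk p.1 ⁻¹' closure (h '' boundedCyl p.2 n))} = ⋂ n, {p : Y × (ℕ → ℕ) |
        ENNReal.ofReal (r' : ℚ) ≤
      κ p.1 (Prod.mk p.1 ⁻¹' closure (h '' boundedCyl p.2 n))} := by
    ext; simp
  rw [this]
  exact .iInter fun n => measurableSet_le measurable_const
    (measurable_kernel_closure_boundedCyl κ h n)

end Kernel

section FiniteDim

variable {E : Type*} [NormedAddCommGroup E] [NormedSpace ℝ E]

/-- The cone of pairs `(v, r)` with `v = c • a + w` and `r ≥ c * (q - b)` for some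
`c ≥ 0`, `(a, b) ∈ G` and `w ∈ W`. -/
def hedgeCone (G : Set (E × ℝ)) (hG : Convex ℝ G) (hne : G.Nonempty) (W : Submodule ℝ E) (q : ℝ) :
    PointedCone ℝ (E × ℝ) where
  carrier := {x | ∃ c : ℝ, 0 ≤ c ∧ ∃ p ∈ G, ∃ w ∈ W, x.1 = c • p.1 + w ∧ c * (q - p.2) ≤ x.2}
  zero_mem' := by
    obtain ⟨p, hp⟩ := hne
    exact ⟨0, le_rfl, p, hp, 0, W.zero_mem, by simp, by simp⟩
  add_mem' := by
    rintro x x' ⟨c, hc, p, hp, w, hw, hx, hxr⟩ ⟨c', hc', p', hp', w', hw', hx', hxr'⟩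
    rcases (add_nonneg hc hc').eq_or_lt with h0 | hpos
    · have h1 : c = 0 := by linarith
      have h2 : c' = 0 := by linarith
      subst h1 h2
      refine ⟨0, le_rfl, p, hp, w + w', W.add_mem hw hw', by simp [hx, hx'], ?_⟩
      simp only [zero_mul, Prod.snd_add] at *
      linarith
    · refine ⟨c + c', hpos.le, (c / (c + c')) • p + (c' / (c + c')) • p',
        hG hp hp' (by positivity) (by positivity) (by field_simp), w + w', W.add_mem hw hw', ?_, ?_⟩
      · simp only [Prod.fst_add, hx, hx', Prod.smul_fst, smul_add, smul_smul]
        rw [mul_div_cancel₀ _ hpos.ne', mul_div_cancel₀ _ hpos.ne']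
        abel
      · simp only [Prod.snd_add, Prod.smul_snd, smul_eq_mul]
        calc _ = c * (q - p.2) + c' * (q - p'.2) := by field_simp; ring
          _ ≤ _ := add_le_add hxr hxr'
  smul_mem' := by
    rintro ⟨k, hk⟩ x ⟨c, hc, p, hp, w, hw, hx, hxr⟩
    refine ⟨k * c, mul_nonneg hk hc, p, hp, k • w, W.smul_mem k hw, ?_, ?_⟩
    · change k • x.1 = _
      rw [hx, smul_add, smul_smul]
    · change _ ≤ k * x.2
      rw [mul_assoc]
      exact mul_le_mul_of_nonneg_left hxr hk

variable {G : Set (E × ℝ)}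

/-- If no linear functional is nonnegative and nontrivial on the first projection of `G`, then
the projected cone is the whole space. -/
lemma exists_mem_hedgeCone [FiniteDimensional ℝ E] (hG : Convex ℝ G) (hne : G.Nonempty)
    (hNA : ∀ l : E →ₗ[ℝ] ℝ, (∀ p ∈ G, 0 ≤ l p.1) → ∀ p ∈ G, l p.1 = 0)
    {W : Submodule ℝ E} (hW : Submodule.span ℝ (Prod.fst '' G) ⊔ W = ⊤) (q : ℝ) (v : E) :
    ∃ r, (v, r) ∈ hedgeCone G hG hne W q := by
  set K : Set E := Prod.fst '' (hedgeCone G hG hne W q : Set (E × ℝ)) with hK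
  by_contra hv
  have hvK : v ∉ K := by
    rintro ⟨⟨v', r⟩, hx, rfl⟩
    exact hv ⟨r, hx⟩
  have hGK : ∀ p ∈ G, p.1 ∈ K := fun p hp =>
    ⟨(p.1, q - p.2), ⟨1, zero_le_one, p, hp, 0, W.zero_mem, by simp, by simp⟩, rfl⟩
  have hWK : ∀ w ∈ W, w ∈ K := fun w hw => by
    obtain ⟨p, hp⟩ := hne
    exact ⟨(w, 0), ⟨0, le_rfl, p, hp, w, hw, by simp, by simp⟩, rfl⟩
  have hKsmul : ∀ c : ℝ, 0 ≤ c → ∀ x ∈ K, c • x ∈ K := by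
    rintro c hc _ ⟨x, hx, rfl⟩
    exact ⟨c • x, (hedgeCone G hG hne W q).smul_mem hc hx, rfl⟩
  have hKadd : ∀ x ∈ K, ∀ y ∈ K, x + y ∈ K := by
    rintro _ ⟨x, hx, rfl⟩ _ ⟨y, hy, rfl⟩
    exact ⟨x + y, (hedgeCone G hG hne W q).add_mem hx hy, rfl⟩
  have hKc : Convex ℝ K := fun x hx y hy a b ha hb _ =>
    hKadd _ (hKsmul a ha x hx) _ (hKsmul b hb y hy)
  have hspan : Submodule.span ℝ K = ⊤ := by
    rw [eq_top_iff, ← hW]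
    refine sup_le (Submodule.span_mono ?_) fun w hw => Submodule.subset_span (hWK w hw)
    rintro _ ⟨p, hp, rfl⟩
    exact hGK p hp
  have hinter : (interior K).Nonempty := by
    rw [hKc.interior_nonempty_iff_affineSpan_eq_top, ← AffineSubspace.coe_eq_univ_iff,
      ← insert_eq_of_mem (hWK 0 W.zero_mem), affineSpan_insert_zero, hspan]
    rfl
  obtain ⟨l, hl⟩ := geometric_hahn_banach_open_point hKc.interior isOpen_interior
    (fun h => hvK (interior_subset h))
  have hle : ∀ x ∈ K, l x ≤ l v := by
    intro x hx
    have hcl : x ∈ closure (interior K) := by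
      rw [hKc.closure_interior_eq_closure_of_nonempty_interior hinter]
      exact subset_closure hx
    exact closure_minimal (fun y hy => (hl y hy).le) (isClosed_Iic.preimage l.continuous) hcl
  have hle0 : ∀ x ∈ K, l x ≤ 0 := by
    intro x hx
    by_contra! hpos
    have h1 := hle _ (hKsmul (|l v| / l x + 1) (by positivity) x hx)
    rw [map_smul, smul_eq_mul, add_mul, div_mul_cancel₀ _ hpos.ne'] at h1
    linarith [le_abs_self (l v)]
  have hG0 : ∀ p ∈ G, l p.1 = 0 := by
    intro p hp
    have := hNA (-l.toLinearMap) (fun p hp => by simpa using hle0 _ (hGK p hp)) p hp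
    simpa using this
  have hl0 : ∀ x, l x = 0 := by
    have : (⊤ : Submodule ℝ E) ≤ LinearMap.ker l.toLinearMap := by
      rw [← hW]
      refine sup_le (Submodule.span_le.2 ?_) fun w hw => ?_
      · rintro _ ⟨p, hp, rfl⟩
        exact hG0 p hp
      · have h1 := hle0 w (hWK w hw)
        have h2 := hle0 (-w) (hWK _ (W.neg_mem hw))
        rw [map_neg] at h2
        have h3 : l w = 0 := le_antisymm h1 (by linarith)
        exact h3
    exact fun x => this trivial
  obtain ⟨x, hx⟩ := hinter
  have := hl x hx
  rw [hl0, hl0] at this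
  exact lt_irrefl _ this

lemma exists_zero_mem_of_noArbitrage [FiniteDimensional ℝ E] (hG : Convex ℝ G) (hne : G.Nonempty)
    (hNA : ∀ l : E →ₗ[ℝ] ℝ, (∀ p ∈ G, 0 ≤ l p.1) → ∀ p ∈ G, l p.1 = 0) :
    ∃ b, ((0 : E), b) ∈ G := by
  obtain ⟨W, hW⟩ := Submodule.exists_isCompl (Submodule.span ℝ (Prod.fst '' G))
  obtain ⟨p₀, hp₀⟩ := id hne
  obtain ⟨r, c, hc, p, hp, w, hw, hx, -⟩ :=
    exists_mem_hedgeCone hG hne hNA hW.sup_eq_top 0 (-p₀.1)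
  have hspan : ∀ p ∈ G, p.1 ∈ Submodule.span ℝ (Prod.fst '' G) := fun p hp =>
    Submodule.subset_span (mem_image_of_mem _ hp)
  have hw0 : w = 0 := by
    refine Submodule.disjoint_def.1 hW.disjoint w ?_ hw
    have : w = -p₀.1 - c • p.1 := by rw [show -p₀.1 = c • p.1 + w from hx]; abel
    rw [this]
    exact Submodule.sub_mem _ (Submodule.neg_mem _ (hspan _ hp₀))
      (Submodule.smul_mem _ _ (hspan _ hp))
  have h1 : (1 + c) ≠ 0 := by positivity
  have hmem := hG hp₀ hp (a := 1 / (1 + c)) (b := c / (1 + c)) (by positivity) (by positivity)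
    (by field_simp)
  refine ⟨((1 / (1 + c)) • p₀ + (c / (1 + c)) • p).2, ?_⟩
  convert hmem using 1
  refine Prod.ext ?_ rfl
  have hx' : c • p.1 = -p₀.1 := by rw [show -p₀.1 = c • p.1 + w from hx, hw0, add_zero]
  simp only [Prod.fst_add, Prod.smul_fst]
  rw [div_eq_inv_mul, div_eq_inv_mul, mul_smul, mul_smul, hx']
  simp

/-- A finite-dimensional superhedging theorem. -/
lemma exists_hedge_of_noArbitrage [FiniteDimensional ℝ E] (hG : Convex ℝ G) (hne : G.Nonempty)
    (hNA : ∀ l : E →ₗ[ℝ] ℝ, (∀ p ∈ G, 0 ≤ l p.1) → ∀ p ∈ G, l p.1 = 0)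
    {q : ℝ} (hq : ∀ b, ((0 : E), b) ∈ G → b ≤ q) :
    ∃ l : E →ₗ[ℝ] ℝ, ∀ p ∈ G, p.2 ≤ q + l p.1 := by
  obtain ⟨W, hW⟩ := Submodule.exists_isCompl (Submodule.span ℝ (Prod.fst '' G))
  have hspan : ∀ p ∈ G, p.1 ∈ Submodule.span ℝ (Prod.fst '' G) := fun p hp =>
    Submodule.subset_span (mem_image_of_mem _ hp)
  let f : E × ℝ →ₗ.[ℝ] ℝ :=
    ⟨LinearMap.ker (LinearMap.fst ℝ E ℝ), (LinearMap.snd ℝ E ℝ).domRestrict _⟩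
  obtain ⟨g, hg, hgs⟩ := riesz_extension (hedgeCone G hG hne W q) f
    (by
      rintro ⟨⟨v, r⟩, hv⟩ ⟨c, hc, p, hp, w, hw, hx, hxr⟩
      change v = 0 at hv
      subst hv
      change 0 ≤ r
      simp only at hx hxr
      have hw0 : w = 0 := by
        refine Submodule.disjoint_def.1 hW.disjoint w ?_ hw
        have : w = -(c • p.1) := by rw [eq_neg_iff_add_eq_zero, add_comm, ← hx]
        rw [this]
        exact Submodule.neg_mem _ (Submodule.smul_mem _ _ (hspan _ hp))
      rw [hw0, add_zero] at hx
      rcases smul_eq_zero.1 hx.symm with h | h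
      · simpa [h] using hxr
      · have : p.2 ≤ q := hq _ (by rw [← h]; exact hp)
        exact (mul_nonneg hc (by linarith)).trans hxr)
    (by
      rintro ⟨v, r⟩
      obtain ⟨r', hr'⟩ := exists_mem_hedgeCone hG hne hNA hW.sup_eq_top q v
      refine ⟨⟨(0, r' - r), rfl⟩, ?_⟩
      simpa using hr')
  refine ⟨g.comp (LinearMap.inl ℝ E ℝ), fun p hp => ?_⟩
  have h1 := hgs (p.1, q - p.2) ⟨1, zero_le_one, p, hp, 0, W.zero_mem, by simp, by simp⟩
  have h2 : g (0, q - p.2) = q - p.2 := hg ⟨(0, q - p.2), rfl⟩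
  have h3 : ((p.1, q - p.2) : E × ℝ) = (p.1, 0) + (0, q - p.2) := by simp
  rw [h3, map_add, h2] at h1
  change p.2 ≤ q + g (p.1, 0)
  linarith

end FiniteDim

section Truncation

variable {X : Type*}

/-- The real-valued truncation of `f` from above at level `n`. -/
def trunc (f : X → EReal) (n : ℕ) (x : X) : ℝ := (min (f x) n).toReal

lemma coe_trunc {f : X → EReal} {x : X} (hx : ⊥ < f x) (n : ℕ) :
    (trunc f n x : EReal) = min (f x) n := by
  refine EReal.coe_toReal ?_ ?_
  · exact ((min_le_right _ _).trans_lt (EReal.coe_lt_top (n : ℝ))).ne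
  · exact (lt_min hx (EReal.bot_lt_coe (n : ℝ))).ne'

lemma trunc_eq_of_neg {f : X → EReal} {x : X} (hx : f x < 0) (n : ℕ) :
    trunc f n x = (f x).toReal := by
  rw [trunc, min_eq_left (hx.le.trans (by positivity))]

lemma trunc_nonneg {f : X → EReal} {x : X} (hx : 0 ≤ f x) (n : ℕ) : 0 ≤ trunc f n x :=
  EReal.toReal_nonneg (le_min hx (by positivity))

lemma trunc_le (f : X → EReal) (n : ℕ) (x : X) : trunc f n x ≤ n := by
  rcases eq_or_ne (f x) ⊥ with h | h
  · simp [trunc, h]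
  · rw [← EReal.coe_le_coe_iff, coe_trunc (bot_lt_iff_ne_bot.2 h)]
    exact min_le_right _ _

lemma abs_trunc_le (f : X → EReal) (n : ℕ) (x : X) : |trunc f n x| ≤ |trunc f 0 x| + n := by
  rcases lt_or_ge (f x) 0 with h | h
  · rw [trunc_eq_of_neg h, trunc_eq_of_neg h]
    simp
  · rw [abs_of_nonneg (trunc_nonneg h n)]
    have := trunc_le f n x
    have := abs_nonneg (trunc f 0 x)
    linarith

end Truncation

section OnePeriodDuality

variable {X : Type*} [MeasurableSpace X] {d : ℕ}

lemma expec_of_integrable {ν : Measure X} {u : X → ℝ} (hu : Integrable u ν) :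
    expec ν u = ((∫ x, u x ∂ν : ℝ) : EReal) := by
  have h1 : ∫⁻ x, ENNReal.ofReal (u x) ∂ν ≠ ⊤ := hu.lintegral_lt_top.ne
  have h2 : ∫⁻ x, ENNReal.ofReal (-u x) ∂ν ≠ ⊤ := hu.neg.lintegral_lt_top.ne
  rw [integral_eq_lintegral_pos_part_sub_lintegral_neg_part hu, expec, EReal.coe_sub,
    EReal.coe_ennreal_toReal h1, EReal.coe_ennreal_toReal h2]

lemma aemeasurable_trunc {f : X → EReal} {ν : Measure X} (hf : AEMeasurable f ν) (n : ℕ) :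
    AEMeasurable (trunc f n) ν :=
  (hf.min aemeasurable_const).ereal_toReal

/-- Probability measures dominated by the family under which the increments and the negative part
of `f` are integrable. -/
structure IsTest (PP : Set (ProbabilityMeasure X)) (Δ : X → Fin d → ℝ) (f : X → EReal)
    (ν : Measure X) : Prop where
  prob : IsProbabilityMeasure ν
  dom : ∃ P ∈ PP, ν ≪ (P : Measure X)
  integrable_incr : ∀ i, Integrable (fun x => Δ x i) ν
  integrable_trunc : ∀ n, Integrable (trunc f n) ν

variable {PP : Set (ProbabilityMeasure X)} {Δ : X → Fin d → ℝ} {f : X → EReal}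

lemma coe_integral_trunc_le_eexpec {ν : Measure X} (hf : ∀ᵐ x ∂ν, ⊥ < f x) {n : ℕ}
    (hi : Integrable (trunc f n) ν) : ((∫ x, trunc f n x ∂ν : ℝ) : EReal) ≤ eexpec ν f := by
  rw [← expec_of_integrable hi, expec, eexpec]
  refine EReal.sub_le_sub ?_ ?_
  · refine EReal.coe_ennreal_le_coe_ennreal_iff.2 (lintegral_mono_ae ?_)
    filter_upwards [hf] with x hx
    rw [posE]
    split_ifs with h
    · exact le_top
    · refine ENNReal.ofReal_le_ofReal ?_
      rw [← EReal.coe_le_coe_iff, coe_trunc hx, EReal.coe_toReal h hx.ne']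
      exact min_le_left _ _
  · refine EReal.coe_ennreal_le_coe_ennreal_iff.2 (lintegral_mono_ae ?_)
    filter_upwards [hf] with x hx
    rw [posE, if_neg (by simpa using hx.ne')]
    rcases lt_or_ge (f x) 0 with h | h
    · rw [trunc_eq_of_neg h]
      simp
    · rw [ENNReal.ofReal_of_nonpos]
      · exact zero_le
      · exact EReal.toReal_nonpos (by simpa using h)

lemma exists_isTest_mem (hΔ : Measurable Δ) (hfm : ∀ P ∈ PP, AEMeasurable f (P : Measure X))
    (hf : ∀ P ∈ PP, ∀ᵐ x ∂(P : Measure X), ⊥ < f x) {P : ProbabilityMeasure X} (hP : P ∈ PP)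
    {B : Set X} (hB : NullMeasurableSet B (P : Measure X)) (hPB : (P : Measure X) B ≠ 0) :
    ∃ ν, IsTest PP Δ f ν ∧ ∀ᵐ x ∂ν, x ∈ B := by
  set D : ℕ → Set X := fun n => B ∩ {x | (∀ i, |Δ x i| ≤ n)} ∩ {x | ((-n : ℝ) : EReal) ≤ f x}
    with hD
  have hDm : ∀ n, NullMeasurableSet (D n) (P : Measure X) := by
    intro n
    refine (hB.inter ?_).inter ?_
    · refine MeasurableSet.nullMeasurableSet ?_
      rw [ofPred_forall]
      exact MeasurableSet.iInter fun i =>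
        measurableSet_le (measurable_pi_iff.1 hΔ i).abs measurable_const
    · exact nullMeasurableSet_le aemeasurable_const (hfm P hP)
  obtain ⟨n, hn⟩ : ∃ n, (P : Measure X) (D n) ≠ 0 := by
    by_contra! h
    refine hPB (measure_mono_null_ae ?_ (measure_iUnion_null h))
    filter_upwards [hf P hP] with x hx hxB
    obtain ⟨n, hn⟩ := exists_nat_ge (max (∑ i, |Δ x i|) (-(f x).toReal))
    refine mem_iUnion.2 ⟨n, ⟨hxB, fun i => ?_⟩, ?_⟩
    · exact (Finset.single_le_sum (f := fun i => |Δ x i|) (fun i _ => abs_nonneg _)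
        (Finset.mem_univ i)).trans ((le_max_left _ _).trans hn)
    · rcases eq_or_ne (f x) ⊤ with h | h
      · simp [h]
      · rw [mem_ofPred_eq, ← EReal.coe_toReal h hx.ne', EReal.coe_le_coe_iff]
        linarith [(le_max_right _ _).trans hn]
  have hac := ProbabilityTheory.cond_absolutelyContinuous (μ := (P : Measure X)) (s := D n)
  have hprob := ProbabilityTheory.cond_isProbabilityMeasure (μ := (P : Measure X)) (s := D n) hn
  have hmem := ProbabilityTheory.ae_cond_mem₀ (hDm n)
  set ν := ProbabilityTheory.cond (P : Measure X) (D n)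
  have htr : Integrable (trunc f 0) ν := by
    refine Integrable.of_bound
      (aemeasurable_trunc ((hfm P hP).mono_ac hac) 0).aestronglyMeasurable n ?_
    filter_upwards [hmem] with x hx
    rcases lt_or_ge (f x) 0 with h | h
    · rw [trunc_eq_of_neg h]
      have h1 : -(n : ℝ) ≤ (f x).toReal := by
        rw [← EReal.coe_le_coe_iff, EReal.coe_toReal (h.trans EReal.zero_lt_top).ne]
        · exact hx.2
        · exact ((EReal.bot_lt_coe _).trans_le hx.2).ne'
      rw [Real.norm_eq_abs, abs_of_nonpos (EReal.toReal_nonpos h.le)]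
      linarith
    · have h1 := trunc_le f 0 x
      have h2 := trunc_nonneg h 0
      rw [Real.norm_eq_abs, abs_of_nonneg h2]
      push_cast at h1
      exact h1.trans (Nat.cast_nonneg n)
  refine ⟨ν, ⟨hprob, ⟨P, hP, hac⟩, fun i => ?_, fun m => ?_⟩, hmem.mono fun x hx => hx.1.1⟩
  · refine Integrable.of_bound (measurable_pi_iff.1 hΔ i).aestronglyMeasurable n ?_
    filter_upwards [hmem] with x hx using hx.1.2 i
  · refine Integrable.mono' (htr.abs.add (integrable_const (m : ℝ)))
      (aemeasurable_trunc ((hfm P hP).mono_ac hac) m).aestronglyMeasurable ?_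
    exact Eventually.of_forall fun x => abs_trunc_le f m x

/-- The pairs formed by the mean increment and a lower bound for the mean truncated claim. -/
def testSet (PP : Set (ProbabilityMeasure X)) (Δ : X → Fin d → ℝ) (f : X → EReal) :
    Set ((Fin d → ℝ) × ℝ) :=
  {p | ∃ ν, IsTest PP Δ f ν ∧ ∃ n, (p.1 = fun i => ∫ x, Δ x i ∂ν) ∧ p.2 ≤ ∫ x, trunc f n x ∂ν}

lemma integral_trunc_mono {ν : Measure X} (hR : IsTest PP Δ f ν) (hf : ∀ᵐ x ∂ν, ⊥ < f x)
    {m n : ℕ} (hmn : m ≤ n) : ∫ x, trunc f m x ∂ν ≤ ∫ x, trunc f n x ∂ν := by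
  refine integral_mono_ae (hR.integrable_trunc m) (hR.integrable_trunc n) ?_
  filter_upwards [hf] with x hx
  rw [← EReal.coe_le_coe_iff, coe_trunc hx, coe_trunc hx]
  exact min_le_min_left _ (by exact_mod_cast hmn)

lemma IsTest.ae_bot_lt (hf : ∀ P ∈ PP, ∀ᵐ x ∂(P : Measure X), ⊥ < f x) {ν : Measure X}
    (hR : IsTest PP Δ f ν) : ∀ᵐ x ∂ν, ⊥ < f x := by
  obtain ⟨P, hP, hac⟩ := hR.dom
  exact hac.ae_le (hf P hP)

lemma convex_testSet (hconv : ConvexPM PP)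
    (hf : ∀ P ∈ PP, ∀ᵐ x ∂(P : Measure X), ⊥ < f x) : Convex ℝ (testSet PP Δ f) := by
  rintro p ⟨ν₁, h₁, n₁, hp1, hp2⟩ p' ⟨ν₂, h₂, n₂, hp1', hp2'⟩ a b ha hb hab
  have hab' : ENNReal.ofReal a + ENNReal.ofReal b = 1 := by
    rw [← ENNReal.ofReal_add ha hb, hab, ENNReal.ofReal_one]
  have hinter : ∀ u : X → ℝ, Integrable u ν₁ → Integrable u ν₂ →
      Integrable u (ENNReal.ofReal a • ν₁ + ENNReal.ofReal b • ν₂) ∧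
      ∫ x, u x ∂(ENNReal.ofReal a • ν₁ + ENNReal.ofReal b • ν₂)
        = a * ∫ x, u x ∂ν₁ + b * ∫ x, u x ∂ν₂ := by
    intro u hu1 hu2
    have e1 := hu1.smul_measure (ENNReal.ofReal_ne_top (r := a))
    have e2 := hu2.smul_measure (ENNReal.ofReal_ne_top (r := b))
    refine ⟨e1.add_measure e2, ?_⟩
    rw [integral_add_measure e1 e2, integral_smul_measure, integral_smul_measure,
      ENNReal.toReal_ofReal ha, ENNReal.toReal_ofReal hb, smul_eq_mul, smul_eq_mul]
  have hpr : ∀ (μ μ' : Measure X), IsProbabilityMeasure μ → IsProbabilityMeasure μ' →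
      IsProbabilityMeasure (ENNReal.ofReal a • μ + ENNReal.ofReal b • μ') := by
    intro μ μ' hμ hμ'
    exact ⟨by simp [hab']⟩
  refine ⟨ENNReal.ofReal a • ν₁ + ENNReal.ofReal b • ν₂, ⟨hpr _ _ h₁.prob h₂.prob, ?_,
    fun i => (hinter _ (h₁.integrable_incr i) (h₂.integrable_incr i)).1,
    fun n => (hinter _ (h₁.integrable_trunc n) (h₂.integrable_trunc n)).1⟩, max n₁ n₂, ?_, ?_⟩
  · obtain ⟨P₁, hP1, hac1⟩ := h₁.dom
    obtain ⟨P₂, hP2, hac2⟩ := h₂.dom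
    exact ⟨⟨ENNReal.ofReal a • (P₁ : Measure X) + ENNReal.ofReal b • (P₂ : Measure X),
      hpr _ _ inferInstance inferInstance⟩, hconv _ hP1 _ hP2 _ _ hab' _ rfl,
      (hac1.smul _).add (hac2.smul _)⟩
  · funext i
    rw [(hinter _ (h₁.integrable_incr i) (h₂.integrable_incr i)).2]
    simp [hp1, hp1']
  · rw [(hinter _ (h₁.integrable_trunc _) (h₂.integrable_trunc _)).2]
    have i1 := integral_trunc_mono h₁ (h₁.ae_bot_lt hf) (le_max_left n₁ n₂)
    have i2 := integral_trunc_mono h₂ (h₂.ae_bot_lt hf) (le_max_right n₁ n₂)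
    exact add_le_add (mul_le_mul_of_nonneg_left (hp2.trans i1) ha)
      (mul_le_mul_of_nonneg_left (hp2'.trans i2) hb)

lemma IsTest.integrable_gain {ν : Measure X} (hR : IsTest PP Δ f ν) (y : Fin d → ℝ) :
    Integrable (fun x => ∑ i, y i * Δ x i) ν :=
  integrable_finsetSum _ fun i _ => (hR.integrable_incr i).const_mul _

lemma IsTest.linearMap_integral {ν : Measure X} (hR : IsTest PP Δ f ν)
    (l : (Fin d → ℝ) →ₗ[ℝ] ℝ) :
    l (fun i => ∫ x, Δ x i ∂ν)
      = ∫ x, ∑ i, l (fun j => if i = j then 1 else 0) * Δ x i ∂ν := by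
  rw [integral_finsetSum _ fun i _ => (hR.integrable_incr i).const_mul _,
    LinearMap.pi_apply_eq_sum_univ]
  refine Finset.sum_congr rfl fun i _ => ?_
  rw [integral_const_mul, smul_eq_mul, mul_comm]

lemma not_ae_pos_of_integral_nonpos {ν : Measure X} [IsProbabilityMeasure ν] {u : X → ℝ}
    (hu : Integrable u ν) (hle : ∫ x, u x ∂ν ≤ 0) (hpos : ∀ᵐ x ∂ν, 0 < u x) : False := by
  have h0 : ∫ x, u x ∂ν = 0 := le_antisymm hle (integral_nonneg_of_ae (hpos.mono fun x h => h.le))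
  have h1 := (integral_eq_zero_iff_of_nonneg_ae (hpos.mono fun x h => h.le) hu).1 h0
  obtain ⟨x, hx, hx'⟩ := (hpos.and h1).exists
  exact hx.ne' hx'

/-- One-period superhedging duality, including existence of a suitable martingale measure. -/
theorem onePeriod_duality (hne : PP.Nonempty) (hconv : ConvexPM PP) (hΔ : Measurable Δ)
    (hfm : ∀ P ∈ PP, AEMeasurable f (P : Measure X))
    (hf : ∀ P ∈ PP, ∀ᵐ x ∂(P : Measure X), ⊥ < f x)
    (hNA : ∀ y : Fin d → ℝ, (∀ P ∈ PP, ∀ᵐ x ∂(P : Measure X), 0 ≤ ∑ i, y i * Δ x i) →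
      ∀ P ∈ PP, ∀ᵐ x ∂(P : Measure X), ∑ i, y i * Δ x i = 0) :
    (∃ Q : ProbabilityMeasure X, (∃ P ∈ PP, (Q : Measure X) ≪ (P : Measure X)) ∧
      (∀ i, expec (Q : Measure X) (fun x => Δ x i) = 0) ∧ ⊥ < eexpec (Q : Measure X) f) ∧
    ∀ q : ℝ, (∀ Q : ProbabilityMeasure X, (∃ P ∈ PP, (Q : Measure X) ≪ (P : Measure X)) →
      (∀ i, expec (Q : Measure X) (fun x => Δ x i) = 0) → eexpec (Q : Measure X) f ≤ q) →
      ∃ y : Fin d → ℝ, ∀ P ∈ PP, ∀ᵐ x ∂(P : Measure X),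
        f x ≤ ((q + ∑ i, y i * Δ x i : ℝ) : EReal) := by
  have hgm : ∀ y : Fin d → ℝ, Measurable fun x => ∑ i, y i * Δ x i := fun y =>
    Finset.measurable_fun_sum _ fun i _ => (measurable_pi_iff.1 hΔ i).const_mul _
  have hGc : Convex ℝ (testSet PP Δ f) := convex_testSet hconv hf
  have hGne : (testSet PP Δ f).Nonempty := by
    obtain ⟨P, hP⟩ := hne
    obtain ⟨ν, hR, -⟩ := exists_isTest_mem hΔ hfm hf hP (B := univ)
      MeasurableSet.univ.nullMeasurableSet (by simp)
    exact ⟨(fun i => ∫ x, Δ x i ∂ν, ∫ x, trunc f 0 x ∂ν), ν, hR, 0, rfl, le_rfl⟩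
  have hGNA : ∀ l : (Fin d → ℝ) →ₗ[ℝ] ℝ, (∀ p ∈ testSet PP Δ f, 0 ≤ l p.1) →
      ∀ p ∈ testSet PP Δ f, l p.1 = 0 := by
    intro l hl
    have hzero := hNA (fun i => l (fun j => if i = j then 1 else 0)) (by
      intro P hP
      rw [ae_iff]
      by_contra hB
      obtain ⟨ν, hR, hRB⟩ := exists_isTest_mem hΔ hfm hf hP
        (measurableSet_le measurable_const (hgm _)).compl.nullMeasurableSet hB
      have hge := hl (fun i => ∫ x, Δ x i ∂ν, ∫ x, trunc f 0 x ∂ν) ⟨ν, hR, 0, rfl, le_rfl⟩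
      rw [hR.linearMap_integral] at hge
      have := hR.prob
      refine not_ae_pos_of_integral_nonpos
        (hR.integrable_gain fun i => l (fun j => if i = j then 1 else 0)).neg ?_
        (hRB.mono fun x hx => ?_)
      · simp only [Pi.neg_apply]
        rw [integral_neg]
        linarith
      · rw [mem_compl_iff, mem_ofPred_eq, not_le] at hx
        simpa using hx)
    rintro p ⟨ν, hR, n, hp1, -⟩
    rw [hp1, hR.linearMap_integral]
    obtain ⟨P, hP, hac⟩ := hR.dom
    exact integral_eq_zero_of_ae (hac.ae_le (hzero P hP))
  have hmart : ∀ ν, IsTest PP Δ f ν → ((0 : Fin d → ℝ) = fun i => ∫ x, Δ x i ∂ν) →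
      ∀ i, expec ν (fun x => Δ x i) = 0 := by
    intro ν hR h0 i
    rw [expec_of_integrable (hR.integrable_incr i), ← congrFun h0 i]
    rfl
  refine ⟨?_, fun q hq => ?_⟩
  · obtain ⟨b, ν, hR, n, h0, hb⟩ := exists_zero_mem_of_noArbitrage hGc hGne hGNA
    refine ⟨⟨ν, hR.prob⟩, hR.dom, hmart ν hR h0, ?_⟩
    exact (EReal.bot_lt_coe _).trans_le
      (coe_integral_trunc_le_eexpec (hR.ae_bot_lt hf) (hR.integrable_trunc n))
  · obtain ⟨l, hl⟩ := exists_hedge_of_noArbitrage hGc hGne hGNA (q := q) (by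
      rintro b ⟨ν, hR, n, h0, hb⟩
      have := (coe_integral_trunc_le_eexpec (hR.ae_bot_lt hf) (hR.integrable_trunc n)).trans
        (hq ⟨ν, hR.prob⟩ hR.dom (hmart ν hR h0))
      exact hb.trans (EReal.coe_le_coe_iff.1 this))
    refine ⟨fun i => l (fun j => if i = j then 1 else 0), fun P hP => ?_⟩
    set w : X → ℝ := fun x => q + ∑ i, l (fun j => if i = j then 1 else 0) * Δ x i with hw
    have hwm : Measurable w := (hgm _).const_add q
    set B : ℕ → Set X := fun n => {x | (w x : EReal) < min (f x) n} with hB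
    have hBnull : ∀ n, (P : Measure X) (B n) = 0 := by
      intro n
      by_contra hne0
      have hBm : NullMeasurableSet (B n) (P : Measure X) :=
        nullMeasurableSet_lt hwm.coe_real_ereal.aemeasurable
          ((hfm P hP).min aemeasurable_const)
      obtain ⟨ν, hR, hRB⟩ := exists_isTest_mem hΔ hfm hf hP hBm hne0
      have hle := hl (fun i => ∫ x, Δ x i ∂ν, ∫ x, trunc f n x ∂ν) ⟨ν, hR, n, rfl, le_rfl⟩
      rw [hR.linearMap_integral] at hle
      have := hR.prob
      have hwi : Integrable w ν := (integrable_const q).add (hR.integrable_gain _)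
      have hwint : ∫ x, w x ∂ν = q + ∫ x, ∑ i, l (fun j => if i = j then 1 else 0) * Δ x i ∂ν := by
        rw [hw, integral_add (integrable_const q) (hR.integrable_gain _)]
        simp
      refine not_ae_pos_of_integral_nonpos ((hR.integrable_trunc n).sub hwi) ?_ ?_
      · simp only [Pi.sub_apply]
        rw [integral_sub (hR.integrable_trunc n) hwi, hwint]
        linarith
      · filter_upwards [hRB, hR.ae_bot_lt hf] with x hx hx'
        rw [hB, mem_ofPred_eq, ← coe_trunc hx', EReal.coe_lt_coe_iff] at hx
        simpa using hx
    rw [ae_iff]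
    refine measure_mono_null (fun x hx => ?_) (measure_iUnion_null hBnull)
    obtain ⟨n, hn⟩ := exists_nat_gt (w x)
    refine mem_iUnion.2 ⟨n, lt_min (not_le.1 hx) ?_⟩
    exact EReal.coe_lt_coe_iff.2 hn

end OnePeriodDuality

section Clamp

/-- The truncation of `z` to `[-n, m]`, shifted by `n`. -/
def clamp (m n : ℕ) (z : EReal) : ℝ := (max ((-n : ℝ) : EReal) (min z (m : ℝ))).toReal + n

lemma coe_clamp_sub (m n : ℕ) (z : EReal) :
    ((clamp m n z - n : ℝ) : EReal) = max ((-n : ℝ) : EReal) (min z (m : ℝ)) := by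
  rw [clamp, add_sub_cancel_right, EReal.coe_toReal]
  · exact (max_lt (EReal.coe_lt_top _) ((min_le_right _ _).trans_lt (EReal.coe_lt_top _))).ne
  · exact ((EReal.bot_lt_coe _).trans_le (le_max_left _ _)).ne'

lemma clamp_le (m n : ℕ) (z : EReal) : clamp m n z ≤ m + n := by
  have h : ((clamp m n z - n : ℝ) : EReal) ≤ (m : ℝ) := by
    rw [coe_clamp_sub]
    refine max_le (EReal.coe_le_coe_iff.2 ?_) (min_le_right _ _)
    exact (neg_nonpos.2 (Nat.cast_nonneg n)).trans (Nat.cast_nonneg m)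
  linarith [EReal.coe_le_coe_iff.1 h]

lemma lt_clamp_iff {m n : ℕ} {z : EReal} {q : ℝ} (hq : 0 ≤ q) :
    q < clamp m n z ↔ q < m + n ∧ ((q - n : ℝ) : EReal) < z := by
  rw [← sub_lt_sub_iff_right (n : ℝ), ← EReal.coe_lt_coe_iff, coe_clamp_sub, lt_max_iff,
    lt_min_iff, EReal.coe_lt_coe_iff, EReal.coe_lt_coe_iff]
  constructor
  · rintro (h | h)
    · linarith
    · exact ⟨by linarith [h.2], h.1⟩
  · rintro ⟨h1, h2⟩
    exact Or.inr ⟨h2, by linarith⟩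

lemma posE_coe (r : ℝ) : posE r = ENNReal.ofReal r := by
  rw [posE, if_neg (EReal.coe_ne_top r), EReal.toReal_coe]

lemma posE_top : posE ⊤ = ⊤ := if_pos rfl

lemma posE_bot : posE ⊥ = 0 := by
  rw [posE, if_neg bot_ne_top, EReal.toReal_bot, ENNReal.ofReal_zero]

lemma ofReal_clamp_add (m n : ℕ) (z : EReal) :
    ENNReal.ofReal (clamp m n z) + min (posE (-z)) n = min (posE z) m + n := by
  have hc := coe_clamp_sub m n z
  induction z with
  | bot =>
    rw [min_eq_left bot_le, max_eq_left bot_le, EReal.coe_eq_coe_iff] at hc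
    rw [show clamp m n ⊥ = 0 by linarith, EReal.neg_bot, posE_top, posE_bot]
    simp
  | top =>
    rw [min_eq_right le_top, max_eq_right (EReal.coe_le_coe_iff.2
      ((neg_nonpos.2 (Nat.cast_nonneg n)).trans (Nat.cast_nonneg m))), EReal.coe_eq_coe_iff] at hc
    rw [show clamp m n ⊤ = m + n by linarith, EReal.neg_top, posE_top, posE_bot,
      ENNReal.ofReal_add (Nat.cast_nonneg _) (Nat.cast_nonneg _)]
    simp
  | coe r =>
    rw [← EReal.coe_strictMono.monotone.map_min, ← EReal.coe_strictMono.monotone.map_max,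
      EReal.coe_eq_coe_iff] at hc
    rw [show clamp m n r = max (-(n : ℝ)) (min r m) + n by linarith, ← EReal.coe_neg, posE_coe, posE_coe,
      ← ENNReal.ofReal_natCast, ← ENNReal.ofReal_natCast, ← ENNReal.ofReal_min,
      ← ENNReal.ofReal_min]
    have hm : (0 : ℝ) ≤ m := Nat.cast_nonneg m
    have hn : (0 : ℝ) ≤ n := Nat.cast_nonneg n
    rcases le_total 0 r with h | h
    · rw [ENNReal.ofReal_of_nonpos ((min_le_left _ _).trans (neg_nonpos.2 h)), add_zero,
        max_eq_right ((neg_nonpos.2 hn).trans (le_min h hm)), ENNReal.ofReal_add (le_min h hm) hn]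
    · rw [ENNReal.ofReal_of_nonpos ((min_le_left _ _).trans h), zero_add,
        min_eq_left (h.trans hm), ← ENNReal.ofReal_add (by linarith [le_max_left (-(n : ℝ)) r])
        (le_min (neg_nonneg.2 h) hn)]
      congr 1
      rcases le_total (-(n : ℝ)) r with h' | h'
      · rw [max_eq_right h', min_eq_left (by linarith)]
        ring
      · rw [max_eq_left h', min_eq_right (by linarith)]
        ring

lemma measurable_clamp (m n : ℕ) : Measurable (clamp m n) :=
  ((measurable_const.max (measurable_id.min measurable_const)).ereal_toReal).add_const _

lemma measurable_posE : Measurable posE :=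
  Measurable.ite (measurableSet_singleton _) measurable_const
    (ENNReal.measurable_ofReal.comp measurable_ereal_toReal)

end Clamp

lemma _root_.MeasureTheory.AnalyticSet.inter {X : Type*} [TopologicalSpace X] [T2Space X]
    {s t : Set X} (hs : AnalyticSet s) (ht : AnalyticSet t) : AnalyticSet (s ∩ t) := by
  rw [inter_eq_iInter]
  exact AnalyticSet.iInter fun b => by cases b <;> assumption

section Semianalytic

variable {X Y : Type*} [TopologicalSpace X] [PolishSpace X] [TopologicalSpace Y] [PolishSpace Y]

lemma UpperSemianalyticE.comp {f : X → EReal} (hf : UpperSemianalyticE f) {g : Y → X}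
    (hg : Continuous g) : UpperSemianalyticE (f ∘ g) := fun c => (hf c).preimage hg

variable [MeasurableSpace X] [BorelSpace X]

lemma UpperSemianalyticE.aemeasurable {f : X → EReal} (hf : UpperSemianalyticE f) (μ : Measure X)
    [IsFiniteMeasure μ] : AEMeasurable f μ := by
  refine NullMeasurable.aemeasurable (m0 := ‹_›) (f := f) (μ := μ) fun s hs => ?_
  refine (measurable_of_Ioi (mδ := (inferInstance : MeasurableSpace (NullMeasurableSpace X μ)))
    (f := f) fun c => ?_) hs
  change NullMeasurableSet (f ⁻¹' Ioi c) μ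
  induction c with
  | bot =>
    have : f ⁻¹' Ioi ⊥ = ⋃ n : ℕ, {x | ((-n : ℝ) : EReal) < f x} := by
      ext x
      simp only [mem_preimage, mem_Ioi, mem_iUnion, mem_ofPred_eq]
      refine ⟨fun h => ?_, fun ⟨n, hn⟩ => (EReal.bot_lt_coe _).trans hn⟩
      obtain ⟨r, -, hr⟩ := EReal.lt_iff_exists_real_btwn.1 h
      obtain ⟨n, hn⟩ := exists_nat_gt (-r)
      exact ⟨n, (EReal.coe_lt_coe_iff.2 (by linarith)).trans hr⟩
    rw [this]
    exact NullMeasurableSet.iUnion fun n => (hf _).nullMeasurableSet μ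
  | top => simp
  | coe r => exact (hf r).nullMeasurableSet μ

lemma UpperSemianalyticE.aemeasurable_section {f : Y × X → EReal} (hf : UpperSemianalyticE f)
    (y : Y) (μ : Measure X) [IsFiniteMeasure μ] : AEMeasurable (fun x => f (y, x)) μ :=
  (hf.comp (Continuous.prodMk_right y)).aemeasurable μ

variable [MeasurableSpace Y] [BorelSpace Y]

lemma analyticSet_lt_lintegral_clamp (κ : ProbabilityTheory.Kernel Y X)
    [ProbabilityTheory.IsFiniteKernel κ] {f : Y × X → EReal} (hf : UpperSemianalyticE f) (m n : ℕ)
    (r : ℝ≥0∞) :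
    AnalyticSet {y | r < ∫⁻ x, ENNReal.ofReal (clamp m n (f (y, x))) ∂(κ y)} := by
  let η : ProbabilityTheory.Kernel Y (X × ℝ) := ProbabilityTheory.Kernel.prod κ
    (ProbabilityTheory.Kernel.const Y ((volume : Measure ℝ).restrict (Icc 0 (m + n))))
  let A : Set (Y × (X × ℝ)) := {p | 0 < p.2.2 ∧ p.2.2 < clamp m n (f (p.1, p.2.1))}
  have hA : AnalyticSet A := by
    have hAeq : A = ⋃ q : ℚ, ({p : Y × (X × ℝ) | 0 < p.2.2 ∧ p.2.2 < q} ∩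
        ({p | (q : ℝ) < m + n} ∩ {p | ((q - n : ℝ) : EReal) < f (p.1, p.2.1)})) := by
      ext p
      simp only [A, mem_ofPred_eq, mem_iUnion, mem_inter_iff]
      constructor
      · rintro ⟨h0, h1⟩
        obtain ⟨q, hq0, hq1⟩ := exists_rat_btwn h1
        exact ⟨q, ⟨h0, hq0⟩, (lt_clamp_iff (h0.trans hq0).le).1 hq1⟩
      · rintro ⟨q, ⟨h0, hq0⟩, hq1⟩
        exact ⟨h0, hq0.trans ((lt_clamp_iff (h0.trans hq0).le).2 hq1)⟩
    rw [hAeq]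
    refine AnalyticSet.iUnion fun q => AnalyticSet.inter ?_ (AnalyticSet.inter ?_ ?_)
    · refine MeasurableSet.analyticSet (IsOpen.measurableSet ?_)
      exact (isOpen_lt continuous_const continuous_snd.snd).inter
        (isOpen_lt continuous_snd.snd continuous_const)
    · exact (MeasurableSet.const _).analyticSet
    · exact (hf _).preimage (f := fun p : Y × (X × ℝ) => (p.1, p.2.1)) (by fun_prop)
  convert analyticSet_lt_kernel η hA r using 4 with y
  have hae : AEMeasurable (fun x => clamp m n (f (y, x))) (κ y) :=
    (measurable_clamp m n).comp_aemeasurable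
      (hf.aemeasurable_section y (κ y))
  have hreg : Prod.mk y ⁻¹' A = regionBetween (fun _ => 0) (fun x => clamp m n (f (y, x))) univ := by
    ext p
    simp [A, regionBetween]
  have hsub : Prod.mk y ⁻¹' A ⊆ univ ×ˢ Icc 0 ((m : ℝ) + n) := fun p hp =>
    ⟨mem_univ _, hp.1.le, hp.2.le.trans (clamp_le _ _ _)⟩
  change _ = η y (Prod.mk y ⁻¹' A)
  rw [ProbabilityTheory.Kernel.prod_apply, ProbabilityTheory.Kernel.const_apply]
  nth_rewrite 2 [← Measure.restrict_univ (μ := κ y)]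
  rw [Measure.prod_restrict, Measure.restrict_apply' (MeasurableSet.univ.prod measurableSet_Icc),
    inter_eq_left.2 hsub, hreg, volume_regionBetween_eq_lintegral aemeasurable_const
    (by rwa [Measure.restrict_univ]) MeasurableSet.univ, Measure.restrict_univ]
  simp

lemma analyticSet_coe_lt_lintegral_clamp (κ : ProbabilityTheory.Kernel Y X)
    [ProbabilityTheory.IsFiniteKernel κ] {f : Y × X → EReal} (hf : UpperSemianalyticE f) (m n : ℕ)
    (r : ℝ) :
    AnalyticSet {y | (r : EReal) <
      ((∫⁻ x, ENNReal.ofReal (clamp m n (f (y, x))) ∂(κ y) : ℝ≥0∞) : EReal)} := by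
  rcases lt_or_ge r 0 with hr | hr
  · convert (MeasurableSet.univ (α := Y)).analyticSet
    refine eq_univ_of_forall fun y => ?_
    exact (EReal.coe_lt_coe_iff.2 hr).trans_le (EReal.coe_ennreal_nonneg _)
  · convert analyticSet_lt_lintegral_clamp κ hf m n (ENNReal.ofReal r) using 4 with y
    rw [← EReal.coe_ennreal_lt_coe_ennreal_iff, EReal.coe_ennreal_ofReal, max_eq_left hr]

end Semianalytic

lemma iSup_lintegral_min {X : Type*} [MeasurableSpace X] {μ : Measure X} {g : X → ℝ≥0∞}
    (hg : AEMeasurable g μ) : ⨆ n : ℕ, ∫⁻ x, min (g x) n ∂μ = ∫⁻ x, g x ∂μ := by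
  rw [← lintegral_iSup' (fun n => hg.min aemeasurable_const)]
  · refine lintegral_congr fun x => ?_
    rw [← inf_iSup_eq (a := g x), ENNReal.iSup_natCast, inf_top_eq]
  · exact Eventually.of_forall fun x m n hmn => min_le_min_left _ (by exact_mod_cast hmn)

lemma lt_eexpec_iff {X : Type*} [MeasurableSpace X] {μ : Measure X} [IsProbabilityMeasure μ]
    {g : X → EReal} (hg : AEMeasurable g μ) (c : ℝ) :
    (c : EReal) < eexpec μ g ↔ ∃ m j : ℕ, ∀ n : ℕ, ((c + 1 / (j + 1) + n : ℝ) : EReal) <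
      ((∫⁻ x, ENNReal.ofReal (clamp m n (g x)) ∂μ : ℝ≥0∞) : EReal) := by
  set a : ℕ → ℝ≥0∞ := fun m => ∫⁻ x, min (posE (g x)) m ∂μ with ha
  set b : ℕ → ℝ≥0∞ := fun n => ∫⁻ x, min (posE (-g x)) n ∂μ with hb
  have hap : AEMeasurable (fun x => posE (g x)) μ := measurable_posE.comp_aemeasurable hg
  have hbp : AEMeasurable (fun x => posE (-g x)) μ := measurable_posE.comp_aemeasurable hg.neg
  have hfin : ∀ (h : X → ℝ≥0∞) (n : ℕ), ∫⁻ x, min (h x) n ∂μ ≠ ⊤ := by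
    intro h n
    refine ne_top_of_le_ne_top (ENNReal.natCast_ne_top n) ?_
    calc ∫⁻ x, min (h x) n ∂μ ≤ ∫⁻ _, n ∂μ := lintegral_mono fun x => min_le_right _ _
      _ = n := by simp
  have key : ∀ m n, (∫⁻ x, ENNReal.ofReal (clamp m n (g x)) ∂μ) + b n = a m + n := by
    intro m n
    rw [hb, ha, ← lintegral_add_right' _ (hbp.min aemeasurable_const)]
    simp_rw [ofReal_clamp_add]
    rw [lintegral_add_right _ measurable_const]
    simp
  have hreal : ∀ (m n j : ℕ), ((c + 1 / (j + 1) + n : ℝ) : EReal) <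
      ((∫⁻ x, ENNReal.ofReal (clamp m n (g x)) ∂μ : ℝ≥0∞) : EReal) ↔
      c + 1 / (j + 1) + (b n).toReal < (a m).toReal := by
    intro m n j
    have hI : (∫⁻ x, ENNReal.ofReal (clamp m n (g x)) ∂μ) ≠ ⊤ := by
      intro h
      have := key m n
      rw [h, top_add] at this
      exact ENNReal.add_ne_top.2 ⟨hfin _ m, ENNReal.natCast_ne_top n⟩ this.symm
    have hk := congrArg ENNReal.toReal (key m n)
    rw [ENNReal.toReal_add hI (hfin _ n), ENNReal.toReal_add (hfin _ m) (ENNReal.natCast_ne_top n),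
      ENNReal.toReal_natCast] at hk
    rw [← EReal.coe_ennreal_toReal hI, EReal.coe_lt_coe_iff]
    constructor <;> intro h <;> linarith
  simp_rw [hreal]
  have hA : ∫⁻ x, posE (g x) ∂μ = ⨆ m, a m := (iSup_lintegral_min hap).symm
  have hB : ∫⁻ x, posE (-g x) ∂μ = ⨆ n, b n := (iSup_lintegral_min hbp).symm
  rw [eexpec, hA, hB]
  constructor
  · intro h
    have hBt : (⨆ n, b n) ≠ ⊤ := by
      intro h'
      rw [h', EReal.coe_ennreal_top, EReal.sub_top] at h
      exact not_lt_bot h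
    set B := (⨆ n, b n).toReal with hBdef
    have hBB : ((⨆ n, b n : ℝ≥0∞) : EReal) = (B : EReal) := (EReal.coe_ennreal_toReal hBt).symm
    rw [hBB] at h
    have h' : ((c + B : ℝ) : EReal) < ((⨆ m, a m : ℝ≥0∞) : EReal) := by
      rw [EReal.coe_add]
      exact EReal.add_lt_of_lt_sub h
    obtain ⟨m, hm⟩ : ∃ m, c + B < (a m).toReal := by
      by_contra! hcon
      have h0 : 0 ≤ c + B := ENNReal.toReal_nonneg.trans (hcon 0)
      have : (⨆ m, a m) ≤ ENNReal.ofReal (c + B) := iSup_le fun m =>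
        (ENNReal.le_ofReal_iff_toReal_le (hfin _ m) h0).2 (hcon m)
      rw [← EReal.coe_ennreal_le_coe_ennreal_iff, EReal.coe_ennreal_ofReal, max_eq_left h0] at this
      exact absurd this (not_le.2 h')
    obtain ⟨j, hj⟩ := exists_nat_one_div_lt (sub_pos.2 hm)
    refine ⟨m, j, fun n => ?_⟩
    have : (b n).toReal ≤ B := ENNReal.toReal_mono hBt (le_iSup b n)
    linarith
  · rintro ⟨m, j, h⟩
    have hj : (0 : ℝ) < 1 / (j + 1) := by positivity
    have h0 : 0 ≤ (a m).toReal - c - 1 / (j + 1) :=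
      (ENNReal.toReal_nonneg (a := b 0)).trans (by linarith [h 0])
    have hBle : (⨆ n, b n) ≤ ENNReal.ofReal ((a m).toReal - c - 1 / (j + 1)) := iSup_le fun n =>
      (ENNReal.le_ofReal_iff_toReal_le (hfin _ n) h0).2 (by linarith [h n])
    have h1 : ((⨆ n, b n : ℝ≥0∞) : EReal) ≤ (((a m).toReal - c - 1 / (j + 1) : ℝ) : EReal) := by
      rwa [← EReal.coe_ennreal_le_coe_ennreal_iff, EReal.coe_ennreal_ofReal,
        max_eq_left h0] at hBle
    have h2 : (((a m).toReal : ℝ) : EReal) ≤ ((⨆ m, a m : ℝ≥0∞) : EReal) := by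
      rw [EReal.coe_ennreal_toReal (hfin _ m)]
      exact EReal.coe_ennreal_le_coe_ennreal_iff.2 (le_iSup a m)
    refine lt_of_lt_of_le ?_ (EReal.sub_le_sub h2 h1)
    rw [← EReal.coe_sub, EReal.coe_lt_coe_iff]
    linarith

/-- Integration against a Markov kernel preserves upper semianalyticity. -/
theorem upperSemianalyticE_eexpec {X Y : Type*} [TopologicalSpace X] [PolishSpace X]
    [TopologicalSpace Y] [PolishSpace Y] [MeasurableSpace X] [BorelSpace X] [MeasurableSpace Y]
    [BorelSpace Y] (κ : ProbabilityTheory.Kernel Y X) [ProbabilityTheory.IsMarkovKernel κ]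
    {f : Y × X → EReal} (hf : UpperSemianalyticE f) :
    UpperSemianalyticE fun y => eexpec (κ y) fun x => f (y, x) := by
  intro c
  have : {y | (c : EReal) < eexpec (κ y) fun x => f (y, x)} = ⋃ m : ℕ, ⋃ j : ℕ, ⋂ n : ℕ,
      {y | ((c + 1 / (j + 1) + n : ℝ) : EReal) <
        ((∫⁻ x, ENNReal.ofReal (clamp m n (f (y, x))) ∂(κ y) : ℝ≥0∞) : EReal)} := by
    ext y
    rw [mem_ofPred_eq, lt_eexpec_iff (hf.aemeasurable_section y (κ y))]
    simp only [mem_iUnion, mem_iInter]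
    rfl
  rw [this]
  exact AnalyticSet.iUnion fun m => AnalyticSet.iUnion fun j => AnalyticSet.iInter fun n =>
    analyticSet_coe_lt_lintegral_clamp κ hf m n _

section DensityCode

variable {X : Type*} [TopologicalSpace X]

lemma exists_open_coding [SecondCountableTopology X] : ∃ O : ℕ → Set X, (∀ l, IsOpen (O l)) ∧
    ∀ U : Set X, IsOpen U → ∃ s : ℕ → ℕ, U = ⋃ j, O (s j) := by
  obtain ⟨B, hBc, -, hB⟩ := TopologicalSpace.exists_countable_basis X
  obtain ⟨O, hO⟩ := (hBc.insert ∅).exists_eq_range (insert_nonempty _ _)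
  refine ⟨O, fun l => ?_, fun U hU => ?_⟩
  · have : O l ∈ insert ∅ B := hO ▸ mem_range_self l
    rcases this with h | h
    · rw [h]
      exact isOpen_empty
    · exact hB.isOpen h
  · obtain ⟨S, hS, rfl⟩ := hB.open_eq_sUnion hU
    obtain ⟨g, hg⟩ := ((hBc.mono hS).insert ∅).exists_eq_range (insert_nonempty _ _)
    have : ∀ j, ∃ l, O l = g j := by
      intro j
      have h1 : g j ∈ insert ∅ S := hg ▸ mem_range_self j
      have h2 : g j ∈ range O := hO ▸ insert_subset_insert hS h1
      exact h2
    choose s hs using this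
    refine ⟨s, ?_⟩
    simp_rw [hs]
    rw [← sUnion_range, ← hg, sUnion_insert, empty_union]

open Classical in
/-- The function coded by `k`: the supremum of the values `e i` over the coded `Gδ` sets. -/
def codedDensity (O : ℕ → Set X) (e : ℕ → ℝ≥0∞) (k : ℕ × ℕ × ℕ → ℕ) (x : X) : ℝ≥0∞ :=
  ⨆ i, if ∀ m, ∃ j, x ∈ O (k (i, m, j)) then e i else 0

variable [MeasurableSpace X]

lemma measurable_codedDensity [BorelSpace X] {O : ℕ → Set X} (hO : ∀ l, IsOpen (O l)) (e : ℕ → ℝ≥0∞) :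
    Measurable (Function.uncurry (codedDensity O e)) := by
  refine Measurable.iSup fun i => ?_
  have hm : MeasurableSet {p : (ℕ × ℕ × ℕ → ℕ) × X | ∀ m, ∃ j, p.2 ∈ O (p.1 (i, m, j))} := by
    have : {p : (ℕ × ℕ × ℕ → ℕ) × X | ∀ m, ∃ j, p.2 ∈ O (p.1 (i, m, j))} =
        ⋂ m, ⋃ j, ⋃ l, ({k | k (i, m, j) = l} ×ˢ O l) := by
      ext p
      simp
    rw [this]
    refine MeasurableSet.iInter fun m => MeasurableSet.iUnion fun j => MeasurableSet.iUnion fun l =>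
      MeasurableSet.prod ?_ (hO l).measurableSet
    exact measurableSet_eq_fun (measurable_pi_apply _) measurable_const
  exact Measurable.ite hm measurable_const measurable_const

lemma iSup_ite_lt {e : ℕ → ℝ≥0∞} (he : DenseRange e) (z : ℝ≥0∞) :
    ⨆ i, (if e i < z then e i else 0) = z := by
  refine le_antisymm (iSup_le fun i => ?_) (le_of_forall_lt fun a ha => ?_)
  · split_ifs with h
    · exact h.le
    · exact zero_le
  · obtain ⟨i, hi1, hi2⟩ := he.exists_mem_open isOpen_Ioo (nonempty_Ioo.2 ha)
    refine hi1.trans_le (le_iSup_of_le i ?_)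
    rw [if_pos hi2]

lemma exists_codedDensity_ae_eq {O : ℕ → Set X}
    (hO : ∀ U : Set X, IsOpen U → ∃ s : ℕ → ℕ, U = ⋃ j, O (s j)) {e : ℕ → ℝ≥0∞}
    (he : DenseRange e) (μ : Measure X) [IsFiniteMeasure μ] [μ.OuterRegular] {h : X → ℝ≥0∞}
    (hh : Measurable h) : ∃ k, codedDensity O e k =ᵐ[μ] h := by
  classical
  have hL : ∀ i, MeasurableSet {x | e i < h x} := fun i => measurableSet_lt measurable_const hh
  have : ∀ i m : ℕ, ∃ s : ℕ → ℕ, {x | e i < h x} ⊆ ⋃ j, O (s j) ∧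
      μ ((⋃ j, O (s j)) \ {x | e i < h x}) < (m + 1 : ℝ≥0∞)⁻¹ := by
    intro i m
    obtain ⟨U, hU, hUo, -, hUm⟩ := (hL i).exists_isOpen_sdiff_lt (measure_ne_top μ _)
      (ε := (m + 1 : ℝ≥0∞)⁻¹) (by simp)
    obtain ⟨s, rfl⟩ := hO U hUo
    exact ⟨s, hU, hUm⟩
  choose s hs hsm using this
  refine ⟨fun p => s p.1 p.2.1 p.2.2, ?_⟩
  have hae : ∀ i, ∀ᵐ x ∂μ, (∀ m, ∃ j, x ∈ O (s i m j)) → e i < h x := by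
    intro i
    rw [ae_iff]
    refine le_antisymm (ENNReal.le_of_forall_pos_le_add fun ε hε _ => ?_) zero_le
    obtain ⟨m, hm⟩ := ENNReal.exists_inv_nat_lt (ENNReal.coe_pos.2 hε).ne'
    rw [zero_add]
    calc μ _ ≤ μ ((⋃ j, O (s i m j)) \ {x | e i < h x}) := by
          refine measure_mono fun x hx => ?_
          rw [mem_ofPred_eq, Classical.not_imp] at hx
          exact ⟨mem_iUnion.2 (hx.1 m), hx.2⟩
      _ ≤ (m + 1 : ℝ≥0∞)⁻¹ := (hsm i m).le
      _ ≤ (m : ℝ≥0∞)⁻¹ := ENNReal.inv_le_inv.2 le_self_add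
      _ ≤ ε := hm.le
  filter_upwards [ae_all_iff.2 hae] with x hx
  rw [← iSup_ite_lt he (h x), codedDensity]
  refine iSup_congr fun i => ?_
  refine if_congr ⟨hx i, fun hi m => mem_iUnion.1 (hs i m hi)⟩ rfl rfl

end DensityCode

open ProbabilityTheory in
/-- All probability measures dominated by the members of a continuously parametrized family are
the values of a single Markov kernel. -/
lemma exists_kernel_dominated {X Z : Type*} [TopologicalSpace X] [PolishSpace X]
    [MeasurableSpace X] [BorelSpace X] [Nonempty X] [TopologicalSpace Z] [MeasurableSpace Z]
    [BorelSpace Z] {p : Z → ProbabilityMeasure X} (hp : Continuous p) :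
    ∃ (κ : Kernel (Z × (ℕ × ℕ × ℕ → ℕ)) X) (E : Set (Z × (ℕ × ℕ × ℕ → ℕ))),
      IsMarkovKernel κ ∧ MeasurableSet E ∧ (∀ z ∈ E, κ z ≪ (p z.1 : Measure X)) ∧
      ∀ z (Q : Measure X), IsProbabilityMeasure Q → Q ≪ (p z : Measure X) →
        ∃ k, (z, k) ∈ E ∧ κ (z, k) = Q := by
  classical
  obtain ⟨O, hOo, hO⟩ := exists_open_coding (X := X)
  set e := TopologicalSpace.denseSeq ℝ≥0∞
  have he : DenseRange e := TopologicalSpace.denseRange_denseSeq _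
  let κ₀ : Kernel (Z × (ℕ × ℕ × ℕ → ℕ)) X :=
    ⟨fun z => (p z.1 : Measure X), (measurable_coe_of_continuous hp).comp measurable_fst⟩
  have : IsMarkovKernel κ₀ := ⟨fun z => by change IsProbabilityMeasure (p z.1 : Measure X); infer_instance⟩
  have hZ : Measurable (Function.uncurry fun (z : Z × (ℕ × ℕ × ℕ → ℕ)) x => codedDensity O e z.2 x) :=
    (measurable_codedDensity hOo e).comp (measurable_fst.snd.prodMk measurable_snd)
  let κ₁ : Kernel (Z × (ℕ × ℕ × ℕ → ℕ)) X := Kernel.withDensity κ₀ fun z x => codedDensity O e z.2 x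
  have hκ₁ : ∀ z, κ₁ z = (p z.1 : Measure X).withDensity (codedDensity O e z.2) := fun z =>
    Kernel.withDensity_apply κ₀ hZ z
  let E : Set (Z × (ℕ × ℕ × ℕ → ℕ)) := {z | κ₁ z univ = 1}
  have hE : MeasurableSet E := κ₁.measurable_coe MeasurableSet.univ (measurableSet_singleton 1)
  let κ : Kernel (Z × (ℕ × ℕ × ℕ → ℕ)) X :=
    Kernel.piecewise hE κ₁ (Kernel.const _ (Measure.dirac (Classical.arbitrary X)))
  have hκ : ∀ z ∈ E, κ z = κ₁ z := fun z hz => by rw [Kernel.piecewise_apply, if_pos hz]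
  refine ⟨κ, E, ⟨fun z => ?_⟩, hE, fun z hz => ?_, fun z Q hQ hQp => ?_⟩
  · by_cases hz : z ∈ E
    · rw [hκ z hz]
      exact ⟨hz⟩
    · rw [Kernel.piecewise_apply, if_neg hz, Kernel.const_apply]
      infer_instance
  · rw [hκ z hz, hκ₁]
    exact withDensity_absolutelyContinuous _ _
  · obtain ⟨k, hk⟩ := exists_codedDensity_ae_eq hO he (p z : Measure X)
      (Measure.measurable_rnDeriv Q (p z : Measure X))
    have hQ' : κ₁ (z, k) = Q := by
      rw [hκ₁, withDensity_congr_ae hk, Measure.withDensity_rnDeriv_eq _ _ hQp]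
    have hmem : (z, k) ∈ E := by
      change κ₁ (z, k) univ = 1
      rw [hQ', measure_univ]
    exact ⟨k, hmem, (hκ _ hmem).trans hQ'⟩

lemma expec_eq_zero_iff {X : Type*} [MeasurableSpace X] (Q : Measure X) (u : X → ℝ) :
    expec Q u = 0 ↔ ∫⁻ x, ENNReal.ofReal (u x) ∂Q = ∫⁻ x, ENNReal.ofReal (-u x) ∂Q ∧
      ∫⁻ x, ENNReal.ofReal (-u x) ∂Q ≠ ⊤ := by
  rw [expec]
  generalize ∫⁻ x, ENNReal.ofReal (u x) ∂Q = a
  generalize ∫⁻ x, ENNReal.ofReal (-u x) ∂Q = b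
  rcases eq_or_ne b ⊤ with rfl | hb
  · simp
  · rcases eq_or_ne a ⊤ with rfl | ha
    · rw [← EReal.coe_ennreal_toReal hb, EReal.coe_ennreal_top, EReal.top_sub_coe]
      simp [hb.symm]
    · rw [← EReal.coe_ennreal_toReal hb, ← EReal.coe_ennreal_toReal ha, ← EReal.coe_sub,
        EReal.coe_eq_zero, sub_eq_zero, ENNReal.toReal_eq_toReal_iff' ha hb]
      simp [hb]

/-- The one-step sublinear expectation over dominated martingale measures is upper
semianalytic. -/
theorem upperSemianalyticE_sSup_eexpec {W X : Type*} [TopologicalSpace W] [PolishSpace W]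
    [MeasurableSpace W] [BorelSpace W] [TopologicalSpace X] [PolishSpace X] [MeasurableSpace X]
    [BorelSpace X] [Nonempty X] {d : ℕ} {PP : W → Set (ProbabilityMeasure X)}
    (hPP : AnalyticSet {p : W × ProbabilityMeasure X | p.2 ∈ PP p.1}) {Δ : W × X → Fin d → ℝ}
    (hΔ : Measurable Δ) {f : W × X → EReal} (hf : UpperSemianalyticE f) :
    UpperSemianalyticE fun ω => sSup ((fun Q : ProbabilityMeasure X =>
      eexpec (Q : Measure X) (fun x => f (ω, x))) ''
      {Q | (∃ P ∈ PP ω, (Q : Measure X) ≪ (P : Measure X)) ∧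
        ∀ i, expec (Q : Measure X) (fun x => Δ (ω, x) i) = 0}) := by
  intro c
  rw [AnalyticSet] at hPP
  rcases hPP with hemp | ⟨φ, hφ, hrange⟩
  · convert analyticSet_empty (α := W)
    refine eq_empty_of_forall_notMem fun ω hω => ?_
    rw [mem_ofPred_eq, lt_sSup_iff] at hω
    obtain ⟨-, ⟨Q, ⟨⟨P, hP, -⟩, -⟩, -⟩, -⟩ := hω
    exact (hemp ▸ (show (ω, P) ∈ {p : W × ProbabilityMeasure X | p.2 ∈ PP p.1} from hP) :
      (ω, P) ∈ (∅ : Set (W × ProbabilityMeasure X)))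
  obtain ⟨κ, E, hκ, hE, hEdom, hEsurj⟩ := exists_kernel_dominated hφ.snd
  have hmem : ∀ σ, (φ σ).2 ∈ PP (φ σ).1 := fun σ => by
    have : φ σ ∈ {p : W × ProbabilityMeasure X | p.2 ∈ PP p.1} := hrange ▸ mem_range_self σ
    exact this
  let A : Set ((ℕ → ℕ) × (ℕ × ℕ × ℕ → ℕ)) :=
    (E ∩ {z | ∀ i, expec (κ z) (fun x => Δ ((φ z.1).1, x) i) = 0}) ∩
      {z | (c : EReal) < eexpec (κ z) (fun x => f ((φ z.1).1, x))}
  have hφ1 : Continuous fun z : (ℕ → ℕ) × (ℕ × ℕ × ℕ → ℕ) => (φ z.1).1 :=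
    hφ.fst.comp continuous_fst
  have hA : AnalyticSet A := by
    refine AnalyticSet.inter (MeasurableSet.analyticSet (hE.inter ?_)) ?_
    · rw [ofPred_forall]
      refine MeasurableSet.iInter fun i => ?_
      have hm : Measurable fun q : ((ℕ → ℕ) × (ℕ × ℕ × ℕ → ℕ)) × X => Δ ((φ q.1.1).1, q.2) i :=
        (measurable_pi_iff.1 hΔ i).comp ((hφ1.measurable.comp measurable_fst).prodMk measurable_snd)
      have h1 := Measurable.lintegral_kernel_prod_right' (κ := κ) hm.ennreal_ofReal
      have h2 := Measurable.lintegral_kernel_prod_right' (κ := κ) hm.neg.ennreal_ofReal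
      simp_rw [expec_eq_zero_iff]
      exact (measurableSet_eq_fun h1 h2).inter (h2 (measurableSet_singleton ⊤)).compl
    · exact upperSemianalyticE_eexpec κ
        (hf.comp (g := fun q : ((ℕ → ℕ) × (ℕ × ℕ × ℕ → ℕ)) × X => ((φ q.1.1).1, q.2))
          ((hφ1.comp continuous_fst).prodMk continuous_snd)) c
  convert hA.image_of_continuous hφ1
  ext ω
  rw [mem_ofPred_eq, lt_sSup_iff]
  constructor
  · rintro ⟨-, ⟨Q, ⟨⟨P, hP, hQP⟩, hmart⟩, rfl⟩, hlt⟩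
    obtain ⟨σ, hσ⟩ : (ω, P) ∈ range φ := hrange ▸ hP
    obtain ⟨k, hk, hkQ⟩ := hEsurj σ (Q : Measure X) inferInstance (by rwa [hσ])
    refine ⟨(σ, k), ⟨⟨hk, fun i => ?_⟩, ?_⟩, by simp [hσ]⟩
    · rw [hkQ, hσ]
      exact hmart i
    · rw [mem_ofPred_eq, hkQ, hσ]
      exact hlt
  · rintro ⟨z, ⟨⟨hzE, hmart⟩, hlt⟩, rfl⟩
    exact ⟨_, ⟨⟨κ z, inferInstance⟩, ⟨⟨(φ z.1).2, hmem _, hEdom z hzE⟩, hmart⟩, rfl⟩, hlt⟩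

section MinNormSelection

variable {d : ℕ}

lemma continuous_sum_sq : Continuous fun y : Fin d → ℝ => ∑ i, y i ^ 2 := by fun_prop

lemma isCompact_sum_sq_le (r : ℝ) : IsCompact {y : Fin d → ℝ | ∑ i, y i ^ 2 ≤ r} := by
  refine (isCompact_closedBall (0 : Fin d → ℝ) (Real.sqrt r)).of_isClosed_subset
    (isClosed_le continuous_sum_sq continuous_const) fun y hy => ?_
  rw [mem_closedBall_zero_iff, pi_norm_le_iff_of_nonneg (Real.sqrt_nonneg r)]
  intro i
  refine Real.abs_le_sqrt (le_trans ?_ hy)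
  exact Finset.single_le_sum (f := fun i => y i ^ 2) (fun i _ => sq_nonneg _) (Finset.mem_univ i)

lemma exists_min_sum_sq {s : Set (Fin d → ℝ)} (hs : IsClosed s) (hne : s.Nonempty) :
    ∃ y ∈ s, ∀ z ∈ s, ∑ i, y i ^ 2 ≤ ∑ i, z i ^ 2 := by
  obtain ⟨y₀, hy₀⟩ := hne
  obtain ⟨y, hy, hmin⟩ := ((isCompact_sum_sq_le (∑ i, y₀ i ^ 2)).inter_left hs).exists_isMinOn
    ⟨y₀, hy₀, le_refl (∑ i, y₀ i ^ 2)⟩ continuous_sum_sq.continuousOn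
  refine ⟨y, hy.1, fun z hz => ?_⟩
  rcases le_total (∑ i, z i ^ 2) (∑ i, y₀ i ^ 2) with h | h
  · exact hmin ⟨hz, h⟩
  · exact le_trans hy.2 h

lemma eq_of_min_sum_sq {s : Set (Fin d → ℝ)} (hs : Convex ℝ s) {y z : Fin d → ℝ} (hy : y ∈ s)
    (hz : z ∈ s) (hmin : ∀ w ∈ s, ∑ i, y i ^ 2 ≤ ∑ i, w i ^ 2)
    (hle : ∑ i, z i ^ 2 ≤ ∑ i, y i ^ 2) : z = y := by
  have hmid := hmin _ (hs hy hz (a := 1 / 2) (b := 1 / 2) (by norm_num) (by norm_num) (by norm_num))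
  have hpar : ∑ i, ((1 / 2 : ℝ) • y + (1 / 2 : ℝ) • z) i ^ 2
      = (∑ i, y i ^ 2) / 2 + (∑ i, z i ^ 2) / 2 - (∑ i, (z i - y i) ^ 2) / 4 := by
    rw [Finset.sum_div, Finset.sum_div, Finset.sum_div, ← Finset.sum_add_distrib,
      ← Finset.sum_sub_distrib]
    refine Finset.sum_congr rfl fun i _ => ?_
    simp only [Pi.add_apply, Pi.smul_apply, smul_eq_mul]
    ring
  have h0 : ∑ i, (z i - y i) ^ 2 = 0 :=
    le_antisymm (by linarith) (Finset.sum_nonneg fun i _ => sq_nonneg _)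
  funext i
  have := (Finset.sum_eq_zero_iff_of_nonneg fun i _ => sq_nonneg (z i - y i)).1 h0 i
    (Finset.mem_univ i)
  exact sub_eq_zero.1 (pow_eq_zero_iff two_ne_zero |>.1 this)

/-- Measurable selection from a closed convex valued multifunction hitting compact sets
measurably. -/
lemma exists_measurable_selection {W : Type*} [MeasurableSpace W] {Ψ : W → Set (Fin d → ℝ)}
    (hcl : ∀ ω, IsClosed (Ψ ω)) (hcv : ∀ ω, Convex ℝ (Ψ ω))
    (hhit : ∀ K, IsCompact K → MeasurableSet {ω | (Ψ ω ∩ K).Nonempty}) :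
    ∃ y : W → Fin d → ℝ, Measurable y ∧ ∀ ω, (Ψ ω).Nonempty → y ω ∈ Ψ ω := by
  classical
  have hex : ∀ ω, ∃ y, ((Ψ ω).Nonempty → y ∈ Ψ ω ∧ ∀ z ∈ Ψ ω, ∑ i, y i ^ 2 ≤ ∑ i, z i ^ 2) ∧
      (¬ (Ψ ω).Nonempty → y = 0) := by
    intro ω
    by_cases h : (Ψ ω).Nonempty
    · obtain ⟨y, hy, hmin⟩ := exists_min_sum_sq (hcl ω) h
      exact ⟨y, fun _ => ⟨hy, hmin⟩, fun h' => absurd h h'⟩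
    · exact ⟨0, fun h' => absurd h' h, fun _ => rfl⟩
  choose y hy hy0 using hex
  refine ⟨y, measurable_of_isClosed fun C hC => ?_, fun ω h => (hy ω h).1⟩
  have hne : MeasurableSet {ω | (Ψ ω).Nonempty} := by
    have : {ω | (Ψ ω).Nonempty} = ⋃ n : ℕ, {ω | (Ψ ω ∩ {y | ∑ i, y i ^ 2 ≤ n}).Nonempty} := by
      ext ω
      simp only [mem_ofPred_eq, mem_iUnion]
      refine ⟨fun ⟨z, hz⟩ => ?_, fun ⟨n, hn⟩ => hn.left⟩
      obtain ⟨n, hn⟩ := exists_nat_ge (∑ i, z i ^ 2)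
      exact ⟨n, z, hz, hn⟩
    rw [this]
    exact MeasurableSet.iUnion fun n => hhit _ (isCompact_sum_sq_le _)
  have hpre : y ⁻¹' C = ({ω | (Ψ ω).Nonempty}ᶜ ∩ {_ω | (0 : Fin d → ℝ) ∈ C}) ∪
      ({ω | (Ψ ω).Nonempty} ∩ ⋂ r : ℚ, ({ω | (Ψ ω ∩ {y | ∑ i, y i ^ 2 ≤ r}).Nonempty}ᶜ ∪
        {ω | (Ψ ω ∩ (C ∩ {y | ∑ i, y i ^ 2 ≤ r})).Nonempty})) := by
    ext ω
    by_cases h : (Ψ ω).Nonempty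
    · simp only [mem_preimage, mem_union, mem_inter_iff, mem_compl_iff, mem_ofPred_eq, h,
        not_true_eq_false, false_and, false_or, true_and, mem_iInter]
      constructor
      · intro hC r
        rw [or_iff_not_imp_left, not_not]
        rintro ⟨z, hz, hzr⟩
        exact ⟨y ω, (hy ω h).1, hC, ((hy ω h).2 z hz).trans hzr⟩
      · intro hr
        have hr' : ∀ r : ℚ, ∑ i, y ω i ^ 2 ≤ r →
            (Ψ ω ∩ (C ∩ {y | ∑ i, y i ^ 2 ≤ (r : ℝ)})).Nonempty := fun r hyr =>
          (hr r).resolve_left (not_not.2 ⟨y ω, (hy ω h).1, hyr⟩)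
        obtain ⟨r₀, hr₀⟩ := exists_rat_gt (∑ i, y ω i ^ 2)
        obtain ⟨z₀, hz₀, hz₀C, -⟩ := hr' r₀ hr₀.le
        obtain ⟨z, hz, hzmin⟩ := exists_min_sum_sq ((hcl ω).inter hC) ⟨z₀, hz₀, hz₀C⟩
        have hle : ∑ i, z i ^ 2 ≤ ∑ i, y ω i ^ 2 := by
          refine le_of_forall_gt_imp_ge_of_dense fun a ha => ?_
          obtain ⟨r, hr1, hr2⟩ := exists_rat_btwn ha
          obtain ⟨w, hw, hwC, hwr⟩ := hr' r hr1.le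
          exact (hzmin w ⟨hw, hwC⟩).trans (hwr.trans hr2.le)
        rw [← eq_of_min_sum_sq (hcv ω) (hy ω h).1 hz.1 (hy ω h).2 hle]
        exact hz.2
    · simp [h, hy0 ω h]
  rw [hpre]
  refine (hne.compl.inter (MeasurableSet.const _)).union (hne.inter (MeasurableSet.iInter fun r =>
    ((hhit _ (isCompact_sum_sq_le _)).compl.union (hhit _ ?_))))
  exact (isCompact_sum_sq_le _).inter_left hC

end MinNormSelection

section Hedges

variable {W X : Type*} [MeasurableSpace X] {d : ℕ} {PP : W → Set (ProbabilityMeasure X)}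
  {Δ : W × X → Fin d → ℝ} {f : W × X → EReal} {E : W → EReal}

/-- The strategies superhedging `f` at the price `E`, wherever the latter is finite. -/
def hedges (PP : W → Set (ProbabilityMeasure X)) (Δ : W × X → Fin d → ℝ) (f : W × X → EReal)
    (E : W → EReal) (ω : W) : Set (Fin d → ℝ) :=
  {y | ∃ e : ℝ, E ω = e ∧ ∀ P ∈ PP ω, ∀ᵐ x ∂(P : Measure X),
    f (ω, x) ≤ ((e + ∑ i, y i * Δ (ω, x) i : ℝ) : EReal)}

lemma mem_hedges_of_tendsto {ω : W} {e : ℝ} (hE : E ω = e) {k : ℕ → Fin d → ℝ} {y : Fin d → ℝ}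
    (hk : Tendsto k atTop (𝓝 y)) {δ : ℕ → ℝ} (hδ : Tendsto δ atTop (𝓝 0))
    (h : ∀ n, ∀ P ∈ PP ω, ∀ᵐ x ∂(P : Measure X), f (ω, x) ≤
      ((e + ∑ i, k n i * Δ (ω, x) i + δ n * (1 + ∑ i, |Δ (ω, x) i|) : ℝ) : EReal)) :
    y ∈ hedges PP Δ f E ω := by
  refine ⟨e, hE, fun P hP => ?_⟩
  filter_upwards [ae_all_iff.2 fun n => h n P hP] with x hx
  have h1 : Tendsto (fun n => ∑ i, k n i * Δ (ω, x) i) atTop (𝓝 (∑ i, y i * Δ (ω, x) i)) :=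
    tendsto_finsetSum _ fun i _ => (tendsto_pi_nhds.1 hk i).mul_const _
  have h2 := (h1.const_add e).add (hδ.mul_const (1 + ∑ i, |Δ (ω, x) i|))
  rw [zero_mul, add_zero] at h2
  exact ge_of_tendsto' ((continuous_coe_real_ereal.tendsto _).comp h2) hx

lemma isClosed_hedges (ω : W) : IsClosed (hedges PP Δ f E ω) := by
  refine IsSeqClosed.isClosed fun k y hk hy => ?_
  obtain ⟨e, he, -⟩ := hk 0
  refine mem_hedges_of_tendsto he hy (δ := fun _ => 0) tendsto_const_nhds fun n P hP => ?_
  obtain ⟨e', he', hn⟩ := hk n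
  obtain rfl : e' = e := EReal.coe_eq_coe_iff.1 (he'.symm.trans he)
  simpa using hn P hP

lemma convex_hedges (ω : W) : Convex ℝ (hedges PP Δ f E ω) := by
  rintro y ⟨e, he, hy⟩ z ⟨e', he', hz⟩ a b ha hb hab
  obtain rfl : e' = e := EReal.coe_eq_coe_iff.1 (he'.symm.trans he)
  refine ⟨e', he, fun P hP => ?_⟩
  filter_upwards [hy P hP, hz P hP] with x hx hx'
  have hsum : e' + ∑ i, (a • y + b • z) i * Δ (ω, x) i
      = a * (e' + ∑ i, y i * Δ (ω, x) i) + b * (e' + ∑ i, z i * Δ (ω, x) i) := by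
    have : ∑ i, (a • y + b • z) i * Δ (ω, x) i
        = a * ∑ i, y i * Δ (ω, x) i + b * ∑ i, z i * Δ (ω, x) i := by
      rw [Finset.mul_sum, Finset.mul_sum, ← Finset.sum_add_distrib]
      refine Finset.sum_congr rfl fun i _ => ?_
      simp only [Pi.add_apply, Pi.smul_apply, smul_eq_mul]
      ring
    rw [this]
    linear_combination (-e') * hab
  rw [hsum]
  have hmin := Convex.min_le_combo (e' + ∑ i, y i * Δ (ω, x) i) (e' + ∑ i, z i * Δ (ω, x) i)
    ha hb hab
  rcases min_le_iff.1 hmin with h | h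
  · exact hx.trans (EReal.coe_le_coe_iff.2 h)
  · exact hx'.trans (EReal.coe_le_coe_iff.2 h)

lemma abs_sum_mul_sub_le {q k v : Fin d → ℝ} {δ : ℝ} (h : ∀ i, |q i - k i| ≤ δ) :
    ∑ i, q i * v i ≤ ∑ i, k i * v i + δ * ∑ i, |v i| := by
  rw [Finset.mul_sum, ← Finset.sum_add_distrib]
  refine Finset.sum_le_sum fun i _ => ?_
  have h1 : (q i - k i) * v i ≤ |q i - k i| * |v i| := by
    rw [← abs_mul]
    exact le_abs_self _
  have h2 := mul_le_mul_of_nonneg_right (h i) (abs_nonneg (v i))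
  linarith

variable [MeasurableSpace W]

lemma measurableSet_hedges_inter_nonempty (hE : Measurable E)
    (hgood : ∀ (y : Fin d → ℝ) (c δ : ℝ), MeasurableSet {ω | ∀ P ∈ PP ω, ∀ᵐ x ∂(P : Measure X),
      f (ω, x) ≤ ((c + ∑ i, y i * Δ (ω, x) i + δ * (1 + ∑ i, |Δ (ω, x) i|) : ℝ) : EReal)})
    {K : Set (Fin d → ℝ)} (hK : IsCompact K) :
    MeasurableSet {ω | (hedges PP Δ f E ω ∩ K).Nonempty} := by
  have heq : {ω | (hedges PP Δ f E ω ∩ K).Nonempty} = ⋂ j : ℕ, ⋃ q : Fin d → ℚ,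
      ⋃ _ : ∃ k ∈ K, ∀ i, |(q i : ℝ) - k i| ≤ 1 / (j + 1), ⋃ c : ℚ,
        (E ⁻¹' Icc ((c - 1 / (j + 1) : ℝ) : EReal) ((c + 1 / (j + 1) : ℝ) : EReal) ∩
        {ω | ∀ P ∈ PP ω, ∀ᵐ x ∂(P : Measure X), f (ω, x) ≤ ((c + ∑ i, (q i : ℝ) * Δ (ω, x) i
          + 1 / (j + 1) * (1 + ∑ i, |Δ (ω, x) i|) : ℝ) : EReal)}) := by
    ext ω
    simp only [mem_ofPred_eq, mem_iInter, mem_iUnion, mem_inter_iff, mem_preimage, mem_Icc,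
      exists_prop]
    constructor
    · rintro ⟨y, ⟨e, he, hy⟩, hyK⟩ j
      have hj : (0 : ℝ) < 1 / (j + 1) := by positivity
      have hq : ∀ i, ∃ q : ℚ, |(q : ℝ) - y i| < 1 / (j + 1) := fun i => by
        obtain ⟨q, hq⟩ := exists_rat_near (y i) hj
        exact ⟨q, by rwa [abs_sub_comm]⟩
      choose q hq using hq
      obtain ⟨c, hc⟩ := exists_rat_near e hj
      rw [abs_lt] at hc
      refine ⟨q, ⟨y, hyK, fun i => (hq i).le⟩, c, ⟨?_, ?_⟩, fun P hP => ?_⟩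
      · rw [he, EReal.coe_le_coe_iff]
        linarith
      · rw [he, EReal.coe_le_coe_iff]
        linarith
      · filter_upwards [hy P hP] with x hx
        refine hx.trans (EReal.coe_le_coe_iff.2 ?_)
        have := abs_sum_mul_sub_le (q := y) (k := fun i => (q i : ℝ)) (v := Δ (ω, x))
          (δ := 1 / (j + 1)) fun i => by rw [abs_sub_comm]; exact (hq i).le
        linarith
    · intro h
      choose q hq c hc hgd using h
      choose k hkK hqk using hq
      have hEω : E ω = ((E ω).toReal : EReal) := by
        refine (EReal.coe_toReal ?_ ?_).symm
        · exact ((hc 0).2.trans_lt (EReal.coe_lt_top _)).ne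
        · exact ((EReal.bot_lt_coe _).trans_le (hc 0).1).ne'
      set e := (E ω).toReal
      obtain ⟨y, hyK, ψ, hψ, hlim⟩ := hK.tendsto_subseq hkK
      refine ⟨y, mem_hedges_of_tendsto hEω hlim (δ := fun n => 2 * (1 / ((ψ n : ℝ) + 1))) ?_
        fun n P hP => ?_, hyK⟩
      · simpa using (tendsto_one_div_add_atTop_nhds_zero_nat.comp hψ.tendsto_atTop).const_mul (2 : ℝ)
      · filter_upwards [hgd (ψ n) P hP] with x hx
        refine hx.trans (EReal.coe_le_coe_iff.2 ?_)
        have h1 := abs_sum_mul_sub_le (v := Δ (ω, x)) (hqk (ψ n))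
        have h2 := (hc (ψ n)).1
        rw [hEω, EReal.coe_le_coe_iff] at h2
        simp only [Function.comp_apply]
        linarith
  rw [heq]
  exact MeasurableSet.iInter fun j => MeasurableSet.iUnion fun q => MeasurableSet.iUnion fun _ =>
    MeasurableSet.iUnion fun c => (hE measurableSet_Icc).inter (hgood _ _ _)

lemma exists_measurable_hedge (hE : Measurable E)
    (hgood : ∀ (y : Fin d → ℝ) (c δ : ℝ), MeasurableSet {ω | ∀ P ∈ PP ω, ∀ᵐ x ∂(P : Measure X),
      f (ω, x) ≤ ((c + ∑ i, y i * Δ (ω, x) i + δ * (1 + ∑ i, |Δ (ω, x) i|) : ℝ) : EReal)}) :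
    ∃ y : W → Fin d → ℝ, Measurable y ∧
      ∀ ω, (hedges PP Δ f E ω).Nonempty → y ω ∈ hedges PP Δ f E ω :=
  exists_measurable_selection isClosed_hedges convex_hedges fun _ hK =>
    measurableSet_hedges_inter_nonempty hE hgood hK

end Hedges

lemma analyticSet_section {W X : Type*} [TopologicalSpace W] [PolishSpace W]
    [TopologicalSpace X] [MeasurableSpace X] [OpensMeasurableSpace X]
    {PP : W → Set (ProbabilityMeasure X)}
    (hPP : AnalyticSet {p : W × ProbabilityMeasure X | p.2 ∈ PP p.1})
    (ω : W) : AnalyticSet (PP ω) := by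
  rw [AnalyticSet] at hPP
  rcases hPP with hemp | ⟨φ, hφ, hrange⟩
  · convert analyticSet_empty (α := ProbabilityMeasure X)
    refine eq_empty_of_forall_notMem fun P hP => ?_
    exact (hemp ▸ (show (ω, P) ∈ {p : W × ProbabilityMeasure X | p.2 ∈ PP p.1} from hP) :
      (ω, P) ∈ (∅ : Set (W × ProbabilityMeasure X)))
  · have : PP ω = (fun σ => (φ σ).2) '' {σ | (φ σ).1 = ω} := by
      ext P
      constructor
      · intro hP
        obtain ⟨σ, hσ⟩ : (ω, P) ∈ range φ := hrange ▸ hP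
        exact ⟨σ, by simp [hσ], by simp [hσ]⟩
      · rintro ⟨σ, rfl, rfl⟩
        have : φ σ ∈ {p : W × ProbabilityMeasure X | p.2 ∈ PP p.1} := hrange ▸ mem_range_self σ
        exact this
    rw [this]
    exact (isClosed_eq hφ.fst continuous_const).analyticSet.image_of_continuous hφ.snd

section MeasurableInputs

variable {W X : Type*} [TopologicalSpace W] [PolishSpace W] [TopologicalSpace X] [PolishSpace X]

lemma UpperSemianalyticE.analyticSet_lt {f : X → EReal} (hf : UpperSemianalyticE f)
    [MeasurableSpace X] [BorelSpace X] {w : X → ℝ} (hw : Measurable w) :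
    AnalyticSet {x | (w x : EReal) < f x} := by
  have : {x | (w x : EReal) < f x} = ⋃ q : ℚ, {x | w x < q} ∩ {x | ((q : ℝ) : EReal) < f x} := by
    ext x
    simp only [mem_ofPred_eq, mem_iUnion, mem_inter_iff]
    constructor
    · intro h
      obtain ⟨q, hq1, hq2⟩ := EReal.lt_iff_exists_rat_btwn.1 h
      exact ⟨q, EReal.coe_lt_coe_iff.1 hq1, hq2⟩
    · rintro ⟨q, hq1, hq2⟩
      exact (EReal.coe_lt_coe_iff.2 hq1).trans hq2
  rw [this]
  exact AnalyticSet.iUnion fun q =>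
    (measurableSet_lt hw measurable_const).analyticSet.inter (hf q)

lemma measurableSet_univComp_of_analyticSet [MeasurableSpace W] [BorelSpace W] {s : Set W}
    (hs : AnalyticSet s) : MeasurableSet[univComp W] s := fun μ _ => hs.nullMeasurableSet μ

lemma UpperSemianalyticE.measurable_univComp [MeasurableSpace W] [BorelSpace W] {f : W → EReal}
    (hf : UpperSemianalyticE f) : Measurable[univComp W] f :=
  fun _ hs μ _ => (hf.aemeasurable μ).nullMeasurable hs

variable [MeasurableSpace X] [BorelSpace X] {PP : W → Set (ProbabilityMeasure X)}

lemma analyticSet_exists_measure_pos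
    (hPP : AnalyticSet {p : W × ProbabilityMeasure X | p.2 ∈ PP p.1}) {A : Set (W × X)}
    (hA : AnalyticSet A) :
    AnalyticSet {ω | ∃ P ∈ PP ω, 0 < (P : Measure X) (Prod.mk ω ⁻¹' A)} := by
  rw [AnalyticSet] at hPP
  rcases hPP with hemp | ⟨φ, hφ, hrange⟩
  · convert analyticSet_empty (α := W)
    refine eq_empty_of_forall_notMem fun ω hω => ?_
    obtain ⟨P, hP, -⟩ := hω
    exact (hemp ▸ (show (ω, P) ∈ {p : W × ProbabilityMeasure X | p.2 ∈ PP p.1} from hP) :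
      (ω, P) ∈ (∅ : Set (W × ProbabilityMeasure X)))
  let κ : ProbabilityTheory.Kernel (ℕ → ℕ) X :=
    ⟨fun σ => ((φ σ).2 : Measure X), measurable_coe_of_continuous hφ.snd⟩
  have : ProbabilityTheory.IsMarkovKernel κ := ⟨fun σ => (φ σ).2.2⟩
  have hg : Continuous fun p : (ℕ → ℕ) × X => ((φ p.1).1, p.2) :=
    (hφ.fst.comp continuous_fst).prodMk continuous_snd
  convert (analyticSet_lt_kernel κ (hA.preimage hg) 0).image_of_continuous hφ.fst
  ext ω
  constructor
  · rintro ⟨P, hP, hpos⟩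
    obtain ⟨σ, hσ⟩ : (ω, P) ∈ range φ := hrange ▸ hP
    refine ⟨σ, ?_, by simp [hσ]⟩
    change 0 < ((φ σ).2 : Measure X) (Prod.mk (φ σ).1 ⁻¹' A)
    rwa [hσ]
  · rintro ⟨σ, hpos, rfl⟩
    have : φ σ ∈ {p : W × ProbabilityMeasure X | p.2 ∈ PP p.1} := hrange ▸ mem_range_self σ
    exact ⟨(φ σ).2, this, hpos⟩

lemma measurableSet_univComp_forall_ae_le [MeasurableSpace W] [BorelSpace W]
    (hPP : AnalyticSet {p : W × ProbabilityMeasure X | p.2 ∈ PP p.1}) {f : W × X → EReal}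
    (hf : UpperSemianalyticE f) {w : W × X → ℝ} (hw : Measurable w) :
    MeasurableSet[univComp W]
      {ω | ∀ P ∈ PP ω, ∀ᵐ x ∂(P : Measure X), f (ω, x) ≤ (w (ω, x) : EReal)} := by
  convert (measurableSet_univComp_of_analyticSet
    (analyticSet_exists_measure_pos hPP (hf.analyticSet_lt hw))).compl using 1
  ext ω
  simp only [mem_ofPred_eq, mem_compl_iff, not_exists, not_and, pos_iff_ne_zero, not_not,
    ae_iff, not_le, preimage_ofPred_eq]

end MeasurableInputs

lemma QuasiSure.ae {α : Type*} [MeasurableSpace α] {C : Set (ProbabilityMeasure α)}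
    {p : α → Prop} (h : QuasiSure ((fun P : ProbabilityMeasure α => (P : Measure α)) '' C)
      ‹MeasurableSpace α› p) {P : ProbabilityMeasure α} (hP : P ∈ C) :
    ∀ᵐ x ∂(P : Measure α), p x := by
  obtain ⟨A, -, hsub, hA⟩ := h
  exact measure_mono_null hsub (hA _ ⟨P, hP, rfl⟩)

lemma quasiSure_of_analyticSet {α : Type*} [TopologicalSpace α] [PolishSpace α]
    [MeasurableSpace α] [BorelSpace α] {C : Set (ProbabilityMeasure α)} (hC : AnalyticSet C)
    {p : α → Prop} (hp : AnalyticSet {x | ¬ p x})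
    (h : ∀ P ∈ C, ∀ᵐ x ∂(P : Measure α), p x) :
    QuasiSure ((fun P : ProbabilityMeasure α => (P : Measure α)) '' C) ‹MeasurableSpace α› p := by
  obtain ⟨B, hB, hsub, hnull⟩ := exists_measurableSet_superset_null hp hC h
  exact ⟨B, hB, hsub, by rintro _ ⟨P, hP, rfl⟩; exact hnull P hP⟩

lemma measurable_incr {Ω₁ : Type} [MeasurableSpace Ω₁] {d t : ℕ}
    {S : (t : ℕ) → (Fin t → Ω₁) → Fin d → ℝ} (hS : Measurable (S t))
    (hS' : Measurable (S (t + 1))) :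
    Measurable fun p : (Fin t → Ω₁) × Ω₁ => incr Ω₁ S t p.1 p.2 := by
  have hsnoc : Measurable fun p : (Fin t → Ω₁) × Ω₁ => (Fin.snoc p.1 p.2 : Fin (t + 1) → Ω₁) := by
    refine measurable_pi_iff.2 fun i => ?_
    induction i using Fin.lastCases with
    | last => simpa using measurable_snd
    | cast i =>
      simp only [Fin.snoc_castSucc]
      exact (measurable_pi_apply i).comp measurable_fst
  exact measurable_pi_iff.2 fun i => ((measurable_pi_apply i).comp (hS'.comp hsnoc)).sub
    ((measurable_pi_apply i).comp (hS.comp measurable_fst))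

end BN

open BN in
/-- **Measurable one-step superhedging** (Lemma 4.9). Under `NA(𝒫)`, for `t < T` and
upper semianalytic `f : Ω_t × Ω₁ → ℝ̄`, the conditional superhedging value
`ℰ_t(f)(ω) = sup_{Q ∈ 𝒬_t(ω)} E_Q[f(ω, ·)]` is upper semianalytic, and there is a
universally measurable `y(·)` such that
`ℰ_t(f)(ω) + y(ω)·ΔS_{t+1}(ω,·) ≥ f(ω,·)` holds `𝒫_t(ω)`-q.s. for every `ω` at
which `NA(𝒫_t(ω))` holds and `f(ω,·) > -∞` `𝒫_t(ω)`-q.s. -/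
theorem measurable_one_step_superhedging
    (Ω₁ : Type) [MeasurableSpace Ω₁] [TopologicalSpace Ω₁] [PolishSpace Ω₁]
    [BorelSpace Ω₁] [Nonempty Ω₁] (T d : ℕ)
    (Pt : (t : ℕ) → (Fin t → Ω₁) → Set (ProbabilityMeasure Ω₁))
    (hPtne : ∀ t, t < T → ∀ ω, (Pt t ω).Nonempty)
    (hPtconv : ∀ t, t < T → ∀ ω, ConvexPM (Pt t ω))
    (hPtgraph : ∀ t, t < T →
      AnalyticSet {p : (Fin t → Ω₁) × ProbabilityMeasure Ω₁ | p.2 ∈ Pt t p.1})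
    (S : (t : ℕ) → (Fin t → Ω₁) → Fin d → ℝ) (hS : ∀ t, t ≤ T → Measurable (S t))
    (hNA : NA Ω₁ (MeasFam Ω₁ Pt T) S (fun i : Fin 0 => i.elim0))
    (t : ℕ) (ht : t < T)
    (f : (Fin t → Ω₁) × Ω₁ → EReal) (hf : UpperSemianalyticE f) :
    let Et : (Fin t → Ω₁) → EReal := fun ω =>
      sSup ((fun Q : ProbabilityMeasure Ω₁ =>
        eexpec (Q : Measure Ω₁) (fun x => f (ω, x))) '' Q1fam Ω₁ Pt S t ω)
    UpperSemianalyticE Et ∧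
    ∃ y : (Fin t → Ω₁) → Fin d → ℝ,
      @Measurable _ _ (univComp (Fin t → Ω₁)) _ y ∧
      ∀ ω : Fin t → Ω₁,
        NA1 ((fun P : ProbabilityMeasure Ω₁ => (P : Measure Ω₁)) '' Pt t ω)
          (incr Ω₁ S t ω) →
        QuasiSure ((fun P : ProbabilityMeasure Ω₁ => (P : Measure Ω₁)) '' Pt t ω)
          ‹MeasurableSpace Ω₁› (fun x => (⊥ : EReal) < f (ω, x)) →
        QuasiSure ((fun P : ProbabilityMeasure Ω₁ => (P : Measure Ω₁)) '' Pt t ω)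
          ‹MeasurableSpace Ω₁› (fun x =>
            f (ω, x) ≤ Et ω + ((∑ i, y ω i * incr Ω₁ S t ω x i : ℝ) : EReal)) := by
  intro Et
  have hΔ := measurable_incr (hS t ht.le) (hS (t + 1) ht)
  have hEt : UpperSemianalyticE Et := upperSemianalyticE_sSup_eexpec (hPtgraph t ht) hΔ hf
  have hcoord : ∀ i, Measurable fun p : (Fin t → Ω₁) × Ω₁ => incr Ω₁ S t p.1 p.2 i :=
    measurable_pi_iff.1 hΔ
  obtain ⟨y, hy, hhedge⟩ := @exists_measurable_hedge (Fin t → Ω₁) Ω₁ _ d (Pt t)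
    (fun p => incr Ω₁ S t p.1 p.2) f Et (univComp (Fin t → Ω₁)) hEt.measurable_univComp
    fun y c δ => measurableSet_univComp_forall_ae_le (hPtgraph t ht) hf
      (w := fun p => c + ∑ i, y i * incr Ω₁ S t p.1 p.2 i
        + δ * (1 + ∑ i, |incr Ω₁ S t p.1 p.2 i|)) (by fun_prop)
  refine ⟨hEt, y, hy, fun ω hNA1 hbot => ?_⟩
  have hPω := analyticSet_section (hPtgraph t ht) ω
  have hsec : ∀ i, Measurable fun x => incr Ω₁ S t ω x i := fun i =>
    (hcoord i).comp measurable_prodMk_left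
  have hgain : ∀ z : Fin d → ℝ, Measurable fun x => ∑ i, z i * incr Ω₁ S t ω x i := fun z => by
    fun_prop
  have hfω : UpperSemianalyticE fun x => f (ω, x) := hf.comp (Continuous.prodMk_right ω)
  obtain ⟨⟨Q, hQP, hQm, hQ⟩, hdual⟩ := onePeriod_duality (hPtne t ht ω) (hPtconv t ht ω)
    (measurable_pi_iff.2 hsec) (fun P _ => hfω.aemeasurable _) (fun P hP => hbot.ae hP)
    fun z hz P hP => (hNA1 z (quasiSure_of_analyticSet hPω
      (measurableSet_le measurable_const (hgain z)).compl.analyticSet hz)).ae hP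
  rcases eq_or_ne (Et ω) ⊤ with htop | htop
  · refine ⟨∅, MeasurableSet.empty, fun x hx => hx ?_, fun _ _ => measure_empty⟩
    simp only [htop, EReal.top_add_coe, le_top]
  have hle : ∀ R ∈ Q1fam Ω₁ Pt S t ω, eexpec (R : Measure Ω₁) (fun x => f (ω, x)) ≤ Et ω :=
    fun R hR => le_sSup ⟨R, hR, rfl⟩
  have hne : Et ω ≠ ⊥ := (hQ.trans_le (hle Q ⟨hQP, hQm⟩)).ne'
  have hcoe : Et ω = ((Et ω).toReal : EReal) := (EReal.coe_toReal htop hne).symm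
  obtain ⟨z, hz⟩ := hdual (Et ω).toReal fun R hR hRm => by
    rw [← hcoe]
    exact hle R ⟨hR, hRm⟩
  obtain ⟨e, he, hye⟩ := hhedge ω ⟨z, _, hcoe, hz⟩
  simp_rw [he, ← EReal.coe_add]
  refine quasiSure_of_analyticSet hPω ?_ hye
  simp_rw [not_le]
  exact hfω.analyticSet_lt ((hgain _).const_add e)
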